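/- Let n̄ = (n_1,…,n_r) with r ≥ 1 and n_i ≥ 2 for all i, and let k be an integer with 0 ≤ k ≤ Σ_{i∈[r]} ⌊(n_i − 2)/2⌋. Then the smallest dimension of a (k,n̄)-PPSN polytope is exactly 2k + r + 1; that is: (a) there exists a (k,n̄)-PPSN polytope of dimension 2k + r + 1, and (b) every (k,n̄)-PPSN polytope has dimension at least 2k + r + 1. -/

import Mathlib

open Set

section PolytopeDefs

variable {E : Type*} [AddCommGroup E] [Module ℝ E]
variable {E' : Type*} [AddCommGroup E'] [Module ℝ E']

/-- A polytope: the convex hull of a finite set of points. -/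
def IsPolytope (P : Set E) : Prop :=
  ∃ V : Finset E, P = convexHull ℝ (V : Set E)

/-- The dimension of a set of points: the dimension of its affine span. -/
noncomputable def polyDim (P : Set E) : ℕ :=
  Module.finrank ℝ (affineSpan ℝ P).direction

/-- A nonempty exposed face of `P`: a nonempty set of the form
`{x ∈ P | ⟨c,x⟩ = max_{y ∈ P} ⟨c,y⟩}` for a linear functional `c`. -/
def IsFace (P F : Set E) : Prop :=
  F.Nonempty ∧ ∃ c : E →ₗ[ℝ] ℝ, F = {x ∈ P | ∀ y ∈ P, c y ≤ c x}

/-- The `k`-skeleton of `P`: its nonempty faces of dimension at most `k`. -/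
def skel (k : ℕ) (P : Set E) : Set (Set E) :=
  {F | IsFace P F ∧ polyDim F ≤ k}

/-- The set of all nonempty faces of `P`. -/
def facesOf (P : Set E) : Set (Set E) :=
  {F | IsFace P F}

/-- Combinatorial equivalence of `k`-skeletons: the posets of faces of dimension
at most `k`, ordered by inclusion, are order-isomorphic. -/
def SkelEquiv (k : ℕ) (P : Set E) (Q : Set E') : Prop :=
  Nonempty (skel k P ≃o skel k Q)

end PolytopeDefs

/-- The product of standard simplices `Δ_{n 0} × ⋯ × Δ_{n (r-1)}`. -/
def prodSimplex {r : ℕ} (n : Fin r → ℕ) : Set ((i : Fin r) → Fin (n i + 1) → ℝ) :=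
  Set.univ.pi fun i => stdSimplex ℝ (Fin (n i + 1))

/-- `P` is `(k, n̄)`-prodsimplicial-neighborly: it is a polytope whose `k`-skeleton
is combinatorially equivalent to that of the product of simplices `Δ_n̄`. -/
def IsPSN {E : Type*} [AddCommGroup E] [Module ℝ E] (k : ℕ) {r : ℕ} (n : Fin r → ℕ)
    (P : Set E) : Prop :=
  IsPolytope P ∧ SkelEquiv k P (prodSimplex n)

/-- `P` is `(k, n̄)`-projected-prodsimplicial-neighborly: it is `(k, n̄)`-PSN and moreover
the image under a linear map of a polytope whose poset of all nonempty faces is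
order-isomorphic to that of `Δ_n̄`. -/
def IsPPSN {E : Type*} [AddCommGroup E] [Module ℝ E] (k : ℕ) {r : ℕ} (n : Fin r → ℕ)
    (P : Set E) : Prop :=
  IsPSN k n P ∧ ∃ (N : ℕ) (Q : Set (Fin N → ℝ)) (f : (Fin N → ℝ) →ₗ[ℝ] E),
    IsPolytope Q ∧ P = f '' Q ∧ Nonempty (facesOf Q ≃o facesOf (prodSimplex n))

section AlternatingChains

lemma sum_erase_eq_zero_of_symm {ι : Type*} [DecidableEq ι] (S : Finset ι) (g : ι → ι → ZMod 2)
    (hg : ∀ i j, i ≠ j → g i j = g j i) : ∑ i ∈ S, ∑ j ∈ S.erase i, g i j = 0 := by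
  have : ∑ i ∈ S, ∑ j ∈ S.erase i, g i j = ∑ p ∈ S.offDiag, g p.1 p.2 := by
    rw [Finset.sum_sigma']
    refine Finset.sum_bij' (fun p _ => (p.1, p.2)) (fun p _ => ⟨p.1, p.2⟩) ?_ ?_ ?_ ?_ ?_ <;>
      simp +contextual [Finset.mem_offDiag, eq_comm]
  rw [this]
  refine Finset.sum_involution (fun p _ => p.swap) ?_ ?_ ?_ ?_
  · rintro ⟨i, j⟩ h
    simp only [Finset.mem_offDiag] at h
    simp [hg j i (Ne.symm h.2.2), CharTwo.add_self_eq_zero]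
  · rintro ⟨i, j⟩ h _ h'
    simp only [Finset.mem_offDiag] at h
    exact h.2.2 (Prod.ext_iff.1 h').2
  · rintro ⟨i, j⟩ h
    simp only [Finset.mem_offDiag, Prod.swap] at h ⊢
    exact ⟨h.2.1, h.1, Ne.symm h.2.2⟩
  · simp

variable {ι : Type*} [Fintype ι]

/-- The support of a sign vector. -/
def signSupport (X : ι → SignType) : Finset ι := {i | X i ≠ 0}

lemma mem_signSupport {X : ι → SignType} {i : ι} : i ∈ signSupport X ↔ X i ≠ 0 := by
  simp [signSupport]

lemma signSupport_neg (X : ι → SignType) : signSupport (-X) = signSupport X := by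
  ext j
  simp only [mem_signSupport, Pi.neg_apply]
  cases X j <;> decide

variable [DecidableEq ι]

lemma signSupport_update_zero (X : ι → SignType) (i : ι) :
    signSupport (Function.update X i 0) = (signSupport X).erase i := by
  ext j
  rcases eq_or_ne j i with rfl | h <;> simp [mem_signSupport, *]

/-- The parity of the number of chains of sign vectors below `X`, with supports of sizes
`1, …, d`, along which the Boolean `s` alternates and ends with the value `b`. -/
def altCount (s : (ι → SignType) → Bool) : Bool → ℕ → (ι → SignType) → ZMod 2
  | _, 0, _ => 1
  | b, d + 1, X =>
    if s X = b then ∑ i ∈ signSupport X, altCount s (!b) d (Function.update X i 0) else 0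

lemma sum_altCount_eq (s : (ι → SignType) → Bool) (d : ℕ) :
    ∀ (b : Bool) (X : ι → SignType), (signSupport X).card = d + 1 →
      ∑ i ∈ signSupport X, altCount s b d (Function.update X i 0) =
        ∑ i ∈ signSupport X, altCount s (!b) d (Function.update X i 0) := by
  induction d with
  | zero => intro b X _; simp [altCount]
  | succ d ih =>
    intro b X hX
    rw [← sub_eq_zero, ← Finset.sum_sub_distrib,
      ← sum_erase_eq_zero_of_symm (signSupport X)
        (fun i j => altCount s b d (Function.update (Function.update X i 0) j 0))
        (fun i j h => by rw [Function.update_comm h])]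
    refine Finset.sum_congr rfl fun i hi => ?_
    have hc : (signSupport (Function.update X i 0)).card = d + 1 := by
      rw [signSupport_update_zero, Finset.card_erase_of_mem hi, hX]; rfl
    have := ih b _ hc
    rw [signSupport_update_zero] at this
    simp only [altCount, signSupport_update_zero, CharTwo.sub_eq_add, Bool.not_not]
    rw [← this]
    cases b <;> cases s (Function.update X i 0) <;> simp

lemma altCount_add_altCount_not (s : (ι → SignType) → Bool) (d : ℕ) (b : Bool) (X : ι → SignType)
    (hX : (signSupport X).card = d + 1) :
    altCount s b (d + 1) X + altCount s (!b) (d + 1) X =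
      ∑ i ∈ signSupport X, altCount s b d (Function.update X i 0) := by
  have := sum_altCount_eq s d b X hX
  simp only [altCount, Bool.not_not]
  rw [← this]
  cases b <;> cases s X <;> simp

lemma altCount_neg {s : (ι → SignType) → Bool} (hs : ∀ X, X ≠ 0 → s (-X) = !s X) (d : ℕ) :
    ∀ (b : Bool) (X : ι → SignType), (signSupport X).card = d →
      altCount s b d (-X) = altCount s (!b) d X := by
  induction d with
  | zero => intros; simp [altCount]
  | succ d ih =>
    intro b X hX
    have hX0 : X ≠ 0 := by rintro rfl; simp [signSupport] at hX
    simp only [altCount, signSupport_neg, hs X hX0, Bool.not_not]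
    have : ∑ i ∈ signSupport X, altCount s (!b) d (Function.update (-X) i 0) =
        ∑ i ∈ signSupport X, altCount s b d (Function.update X i 0) := by
      refine Finset.sum_congr rfl fun i hi => ?_
      have hneg : Function.update (-X) i 0 = -Function.update X i 0 := by
        ext1 j
        rcases eq_or_ne j i with rfl | h <;> simp [*]
      rw [hneg, ih, Bool.not_not]
      · rw [signSupport_update_zero, Finset.card_erase_of_mem hi, hX]; rfl
    rw [this]
    cases b <;> cases s X <;> simp

lemma sum_altCount_signSupport {s : (ι → SignType) → Bool} (hs : ∀ X, X ≠ 0 → s (-X) = !s X)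
    (b : Bool) (S : Finset ι) :
    ∑ X : ι → SignType with signSupport X = S, altCount s b S.card X = 1 := by
  induction S using Finset.induction_on with
  | empty =>
    have : ({X : ι → SignType | signSupport X = ∅} : Finset _) = {0} := by
      ext X
      simp only [Finset.mem_filter, Finset.mem_univ, true_and, Finset.mem_singleton,
        Finset.eq_empty_iff_forall_notMem, mem_signSupport, not_not, funext_iff, Pi.zero_apply]
    rw [this]; simp [altCount]
  | insert a S ha ih =>
    rw [Finset.card_insert_of_notMem ha]
    set T : Finset (ι → SignType) := {X | signSupport X = insert a S ∧ X a = 1} with hT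
    have h1 : ∑ X : ι → SignType with signSupport X = insert a S, altCount s b (S.card + 1) X =
        ∑ X ∈ T, (altCount s b (S.card + 1) X + altCount s b (S.card + 1) (-X)) := by
      rw [Finset.sum_add_distrib,
        ← Finset.sum_filter_add_sum_filter_not _ (fun X : ι → SignType => X a = 1)]
      congr 1
      · rw [Finset.filter_filter]
      · refine Finset.sum_bij' (fun X _ => -X) (fun X _ => -X) ?_ ?_ ?_ ?_ ?_
        · intro X hX
          simp only [Finset.mem_filter, Finset.mem_univ, true_and, hT, signSupport_neg] at hX ⊢
          refine ⟨hX.1, ?_⟩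
          have : X a ≠ 0 := mem_signSupport.1 (hX.1 ▸ Finset.mem_insert_self a S)
          have h2 := hX.2
          simp only [Pi.neg_apply]
          revert this h2
          cases X a <;> decide
        · intro X hX
          simp only [Finset.mem_filter, Finset.mem_univ, true_and, hT, signSupport_neg,
            Pi.neg_apply] at hX ⊢
          exact ⟨hX.1, by rw [hX.2]; decide⟩
        · simp
        · simp
        · simp
    have h2 : ∀ X ∈ T, altCount s b (S.card + 1) X + altCount s b (S.card + 1) (-X) =
        ∑ i ∈ insert a S, altCount s b S.card (Function.update X i 0) := by
      intro X hX
      simp only [Finset.mem_filter, Finset.mem_univ, true_and, hT] at hX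
      have hc : (signSupport X).card = S.card + 1 := by rw [hX.1, Finset.card_insert_of_notMem ha]
      rw [altCount_neg hs _ _ _ hc, altCount_add_altCount_not s _ _ _ hc, hX.1]
    rw [h1, Finset.sum_congr rfl h2, Finset.sum_comm, Finset.sum_insert ha]
    have h3 : ∑ i ∈ S, ∑ X ∈ T, altCount s b S.card (Function.update X i 0) = 0 := by
      refine Finset.sum_eq_zero fun i hi => ?_
      have hia : i ≠ a := by rintro rfl; exact ha hi
      refine Finset.sum_involution (fun X _ => Function.update X i (-X i)) ?_ ?_ ?_ ?_
      · intro X _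
        simp [CharTwo.add_self_eq_zero]
      · intro X hX _ h
        simp only [Finset.mem_filter, Finset.mem_univ, true_and, hT] at hX
        have : X i ≠ 0 := mem_signSupport.1 (hX.1 ▸ Finset.mem_insert_of_mem hi)
        have h' := congrFun h i
        simp only [Function.update_self] at h'
        revert this h'
        cases X i <;> decide
      · intro X hX
        simp only [Finset.mem_filter, Finset.mem_univ, true_and, hT] at hX ⊢
        refine ⟨?_, by rw [Function.update_of_ne hia.symm]; exact hX.2⟩
        rw [← hX.1]
        ext j
        rcases eq_or_ne j i with rfl | h
        · simp only [mem_signSupport, Function.update_self]; cases X j <;> decide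
        · simp [mem_signSupport, h]
      · intro X _
        simp
    rw [h3, add_zero, ← ih]
    refine Finset.sum_bij' (fun X _ => Function.update X a 0) (fun X _ => Function.update X a 1)
      ?_ ?_ ?_ ?_ ?_
    · intro X hX
      simp only [Finset.mem_filter, Finset.mem_univ, true_and, hT] at hX ⊢
      rw [signSupport_update_zero, hX.1, Finset.erase_insert ha]
    · intro X hX
      simp only [Finset.mem_filter, Finset.mem_univ, true_and, hT, Function.update_self,
        and_true] at hX ⊢
      rw [← hX]
      ext j
      rcases eq_or_ne j a with rfl | h
      · simp [mem_signSupport]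
      · simp [mem_signSupport, h]
    · intro X hX
      simp only [Finset.mem_filter, Finset.mem_univ, true_and, hT] at hX
      simp [← hX.2]
    · intro X hX
      simp only [Finset.mem_filter, Finset.mem_univ, true_and] at hX
      have : X a = 0 := by
        by_contra h
        exact ha (hX ▸ mem_signSupport.2 h)
      simp [← this]
    · simp

lemma le_level_of_altCount_ne_zero {s : (ι → SignType) → Bool} {lev : (ι → SignType) → ℕ}
    (hpos : ∀ X, X ≠ 0 → 1 ≤ lev X)
    (hmono : ∀ X Y : ι → SignType, X ≠ 0 → (∀ i, X i ≠ 0 → Y i = X i) →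
      lev X < lev Y ∨ (lev X = lev Y ∧ s X = s Y)) (d : ℕ) :
    ∀ (b : Bool) (X : ι → SignType), (signSupport X).card = d + 1 → altCount s b (d + 1) X ≠ 0 →
      s X = b ∧ d + 1 ≤ lev X := by
  induction d with
  | zero =>
    intro b X hX h
    have hX0 : X ≠ 0 := by rintro rfl; simp [signSupport] at hX
    refine ⟨?_, hpos X hX0⟩
    by_contra hb
    simp [altCount, hb] at h
  | succ d ih =>
    intro b X hX h
    have hb : s X = b := by
      by_contra hb
      rw [altCount, if_neg hb] at h
      exact h rfl
    refine ⟨hb, ?_⟩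
    rw [altCount, if_pos hb] at h
    obtain ⟨i, hi, hne⟩ := Finset.exists_ne_zero_of_sum_ne_zero h
    have hc : (signSupport (Function.update X i 0)).card = d + 1 := by
      rw [signSupport_update_zero, Finset.card_erase_of_mem hi, hX]; rfl
    obtain ⟨h1, h2⟩ := ih _ _ hc hne
    have hX0 : Function.update X i 0 ≠ 0 := by
      intro h0; rw [h0] at hc; simp [signSupport] at hc
    rcases hmono _ X hX0 (fun j hj => by
      rcases eq_or_ne j i with rfl | hji
      · simp at hj
      · simp [hji]) with h3 | ⟨_, h3⟩
    · omega
    · rw [h1, hb] at h3; cases b <;> simp at h3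

/-- A monotone form of the octahedral Tucker lemma. -/
lemma exists_card_le_level [Nonempty ι] {s : (ι → SignType) → Bool} {lev : (ι → SignType) → ℕ}
    (hs : ∀ X, X ≠ 0 → s (-X) = !s X) (hpos : ∀ X, X ≠ 0 → 1 ≤ lev X)
    (hmono : ∀ X Y : ι → SignType, X ≠ 0 → (∀ i, X i ≠ 0 → Y i = X i) →
      lev X < lev Y ∨ (lev X = lev Y ∧ s X = s Y)) :
    ∃ X : ι → SignType, X ≠ 0 ∧ Fintype.card ι ≤ lev X := by
  have h := sum_altCount_signSupport hs true (Finset.univ : Finset ι)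
  obtain ⟨X, hX, hne⟩ := Finset.exists_ne_zero_of_sum_ne_zero (h.trans_ne one_ne_zero)
  simp only [Finset.mem_filter, Finset.mem_univ, true_and] at hX
  obtain ⟨d, hd⟩ : ∃ d, Fintype.card ι = d + 1 :=
    ⟨_, (Nat.succ_pred_eq_of_pos Fintype.card_pos).symm⟩
  rw [Finset.card_univ, hd] at hne
  have hc : (signSupport X).card = d + 1 := by rw [hX, Finset.card_univ, hd]
  refine ⟨X, ?_, hd ▸ (le_level_of_altCount_ne_zero hpos hmono d _ X hc hne).2⟩
  rintro rfl
  simp [signSupport] at hc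

end AlternatingChains

section FlagLevel

variable {W : Type*} [AddCommGroup W] [Module ℝ W] [FiniteDimensional ℝ W]

/-- The dimension of the first member of the coordinate flag of `W` that meets `C`. -/
noncomputable def flagLevel (C : Set W) : ℕ :=
  sInf {l | ∃ w ∈ C, ∀ i : Fin (Module.finrank ℝ W), l ≤ i → (Module.finBasis ℝ W).repr w i = 0}

open Classical in
/-- The side of the coordinate flag on which `C` first meets it. -/
noncomputable def flagSign (C : Set W) : Bool :=
  decide (∃ w ∈ C, (∀ i : Fin (Module.finrank ℝ W), flagLevel C ≤ i →
    (Module.finBasis ℝ W).repr w i = 0) ∧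
    ∃ i : Fin (Module.finrank ℝ W), (i : ℕ) + 1 = flagLevel C ∧ 0 < (Module.finBasis ℝ W).repr w i)

lemma flagLevel_le_finrank {C : Set W} (hC : C.Nonempty) : flagLevel C ≤ Module.finrank ℝ W := by
  obtain ⟨w, hw⟩ := hC
  exact Nat.sInf_le ⟨w, hw, fun i hi => absurd i.2 (not_lt.2 hi)⟩

lemma flagLevel_mem {C : Set W} (hC : C.Nonempty) : ∃ w ∈ C, ∀ i : Fin (Module.finrank ℝ W),
    flagLevel C ≤ i → (Module.finBasis ℝ W).repr w i = 0 := by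
  obtain ⟨w, hw⟩ := hC
  exact Nat.sInf_mem (s := {l | ∃ w ∈ C, ∀ i : Fin (Module.finrank ℝ W), l ≤ i →
    (Module.finBasis ℝ W).repr w i = 0})
    ⟨Module.finrank ℝ W, w, hw, fun i hi => absurd i.2 (not_lt.2 hi)⟩

lemma one_le_flagLevel {C : Set W} (hC : C.Nonempty) (h0 : (0 : W) ∉ C) : 1 ≤ flagLevel C := by
  by_contra h
  obtain ⟨w, hw, hz⟩ := flagLevel_mem hC
  refine h0 ?_
  have : w = 0 := by
    apply (Module.finBasis ℝ W).repr.injective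
    ext i
    simpa using hz i (by omega)
  exact this ▸ hw

lemma exists_index_flagLevel {C : Set W} (hC : C.Nonempty) (h0 : (0 : W) ∉ C) :
    ∃ i : Fin (Module.finrank ℝ W), (i : ℕ) + 1 = flagLevel C := by
  have h1 := one_le_flagLevel hC h0
  have h2 := flagLevel_le_finrank hC
  exact ⟨⟨flagLevel C - 1, by omega⟩, by simp; omega⟩

lemma repr_ne_zero_of_flagLevel {C : Set W} {w : W} (hw : w ∈ C)
    (hz : ∀ i : Fin (Module.finrank ℝ W), flagLevel C ≤ i → (Module.finBasis ℝ W).repr w i = 0)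
    {i : Fin (Module.finrank ℝ W)} (hi : (i : ℕ) + 1 = flagLevel C) :
    (Module.finBasis ℝ W).repr w i ≠ 0 := by
  intro h
  have : flagLevel C ≤ i := Nat.sInf_le ⟨w, hw, fun j hj => by
    rcases hj.eq_or_lt with h' | h'
    · rw [← Fin.ext h']; exact h
    · exact hz j (by omega)⟩
  omega

lemma flagSign_iff {C : Set W} (hconv : Convex ℝ C) {w : W} (hw : w ∈ C)
    (hz : ∀ i : Fin (Module.finrank ℝ W), flagLevel C ≤ i → (Module.finBasis ℝ W).repr w i = 0)
    {i : Fin (Module.finrank ℝ W)} (hi : (i : ℕ) + 1 = flagLevel C) :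
    flagSign C = true ↔ 0 < (Module.finBasis ℝ W).repr w i := by
  simp only [flagSign, decide_eq_true_iff]
  refine ⟨?_, fun h => ⟨w, hw, hz, i, hi, h⟩⟩
  rintro ⟨v, hv, hvz, j, hj, hpos⟩
  obtain rfl : j = i := Fin.ext (by omega)
  by_contra hneg
  set a := (Module.finBasis ℝ W).repr v j
  set b := (Module.finBasis ℝ W).repr w j with hb
  have hb0 : b < 0 := lt_of_le_of_ne (not_lt.1 hneg) (repr_ne_zero_of_flagLevel hw hz hj)
  have hab : 0 < a - b := by linarith
  have hu : ((-b) / (a - b)) • v + (a / (a - b)) • w ∈ C :=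
    hconv hv hw (div_nonneg (by linarith) hab.le) (div_nonneg hpos.le hab.le)
      (by field_simp; ring)
  refine repr_ne_zero_of_flagLevel hu (fun l hl => ?_) hj ?_
  · simp [hvz l hl, hz l hl]
  · simp only [map_add, map_smul, Finsupp.add_apply, Finsupp.smul_apply, smul_eq_mul]
    change -b / (a - b) * a + a / (a - b) * b = 0
    field_simp
    ring

lemma flagLevel_neg (C : Set W) : flagLevel {w | -w ∈ C} = flagLevel C := by
  unfold flagLevel
  congr 1
  ext l
  constructor
  · rintro ⟨w, hw, h⟩
    exact ⟨-w, hw, fun i hi => by simp [h i hi]⟩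
  · rintro ⟨w, hw, h⟩
    exact ⟨-w, by simpa using hw, fun i hi => by simp [h i hi]⟩

lemma flagSign_neg {C : Set W} (hconv : Convex ℝ C) (hC : C.Nonempty) (h0 : (0 : W) ∉ C) :
    flagSign {w | -w ∈ C} = !flagSign C := by
  obtain ⟨i, hi⟩ := exists_index_flagLevel hC h0
  obtain ⟨w, hw, hz⟩ := flagLevel_mem hC
  have hconv' : Convex ℝ {w | -w ∈ C} := by
    intro x hx y hy a b ha hb hab
    have := hconv hx hy ha hb hab
    simpa [neg_add, add_comm] using this
  have h1 := flagSign_iff hconv hw hz hi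
  have h2 := flagSign_iff hconv' (w := -w) (by simpa using hw)
    (by rw [flagLevel_neg]; intro j hj; simp [hz j hj]) (by rw [flagLevel_neg]; exact hi)
  have h3 := repr_ne_zero_of_flagLevel hw hz hi
  simp only [map_neg, Finsupp.neg_apply, Left.neg_pos_iff] at h2
  rcases lt_or_gt_of_ne h3 with h | h
  · rw [h2.2 h]
    cases hs : flagSign C
    · rfl
    · exact absurd (h1.1 hs) (not_lt.2 h.le)
  · rw [h1.2 h]
    cases hs : flagSign {w | -w ∈ C}
    · rfl
    · exact absurd (h2.1 hs) (not_lt.2 h.le)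

lemma flagLevel_lt_or_eq_of_subset {C C' : Set W} (hconv : Convex ℝ C) (hconv' : Convex ℝ C')
    (h0 : (0 : W) ∉ C) (hC' : C'.Nonempty) (hsub : C' ⊆ C) :
    flagLevel C < flagLevel C' ∨ (flagLevel C = flagLevel C' ∧ flagSign C = flagSign C') := by
  obtain ⟨w, hw, hz⟩ := flagLevel_mem hC'
  have hle : flagLevel C ≤ flagLevel C' := Nat.sInf_le ⟨w, hsub hw, hz⟩
  rcases hle.lt_or_eq with h | h
  · exact Or.inl h
  · obtain ⟨i, hi⟩ := exists_index_flagLevel hC' (fun h => h0 (hsub h))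
    exact Or.inr ⟨h, Bool.eq_iff_iff.2 ((flagSign_iff hconv (hsub hw) (by rwa [h])
      (by rw [h, hi])).trans
      (flagSign_iff hconv' hw hz hi).symm)⟩

end FlagLevel

section SignCone

variable {W : Type*} [AddCommGroup W] [Module ℝ W]

/-- The vectors on which each functional `μ j` has the sign prescribed by `X j ≠ 0`. -/
def signCone {J : Type*} (μ : J → W →ₗ[ℝ] ℝ) (X : J → SignType) : Set W :=
  {w | ∀ j, X j ≠ 0 → 0 < (X j : ℝ) * μ j w}

variable {J : Type*} (μ : J → W →ₗ[ℝ] ℝ)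

lemma convex_signCone (X : J → SignType) : Convex ℝ (signCone μ X) := by
  intro x hx y hy a b ha hb hab j hj
  have h1 := hx j hj
  have h2 := hy j hj
  have : (X j : ℝ) * μ j (a • x + b • y) = a * (X j * μ j x) + b * (X j * μ j y) := by
    simp; ring
  rw [this]
  rcases ha.eq_or_lt with rfl | ha
  · simp at hab; subst hab; simpa using h2
  · nlinarith [mul_pos ha h1, mul_nonneg hb h2.le]

lemma zero_notMem_signCone {X : J → SignType} (hX : X ≠ 0) : (0 : W) ∉ signCone μ X := by
  obtain ⟨j, hj⟩ := Function.ne_iff.1 hX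
  intro h
  simpa using h j hj

lemma signCone_neg (X : J → SignType) : signCone μ (-X) = {w | -w ∈ signCone μ X} := by
  ext w
  simp only [signCone, Set.mem_ofPred_eq, Pi.neg_apply, map_neg]
  refine forall_congr' fun j => ?_
  cases X j <;> simp

lemma signCone_anti {X Y : J → SignType} (h : ∀ j, X j ≠ 0 → Y j = X j) :
    signCone μ Y ⊆ signCone μ X := by
  intro w hw j hj
  rw [← h j hj]
  exact hw j (by rwa [h j hj])

end SignCone

section Majority

variable {J : Type*} [Fintype J] {r : ℕ} (blk : J → Fin r) (κ : Fin r → ℕ)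

/-- The sign taken by at least `κ i + 2` of the entries of `X` in block `i`, if there is one. -/
def majoritySign (X : J → SignType) (i : Fin r) : SignType :=
  if κ i + 2 ≤ Finset.card {j | blk j = i ∧ X j = 1} then 1
  else if κ i + 2 ≤ Finset.card {j | blk j = i ∧ X j = -1} then -1 else 0

variable {blk κ}

lemma majoritySign_eq_neg_one_iff (hcard : ∀ i, Finset.card {j | blk j = i} ≤ 2 * κ i + 3)
    (X : J → SignType) (i : Fin r) :
    majoritySign blk κ X i = -1 ↔ κ i + 2 ≤ Finset.card {j | blk j = i ∧ X j = -1} := by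
  have h : Finset.card {j | blk j = i ∧ X j = 1} + Finset.card {j | blk j = i ∧ X j = -1} ≤
      2 * κ i + 3 := by
    classical
    rw [← Finset.card_union_of_disjoint]
    · refine (Finset.card_le_card fun j => ?_).trans (hcard i)
      simp only [Finset.mem_union, Finset.mem_filter, Finset.mem_univ, true_and]
      tauto
    · rw [Finset.disjoint_filter]
      rintro j _ ⟨_, h1⟩ ⟨_, h2⟩
      rw [h1] at h2
      exact absurd h2 (by decide)
  unfold majoritySign
  split_ifs with h1 h2
  · constructor
    · intro h; exact absurd h (by decide)
    · intro h; omega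
  · simp [h2]
  · constructor
    · intro h; exact absurd h (by decide)
    · intro h; omega

lemma majoritySign_eq_one_iff (X : J → SignType) (i : Fin r) :
    majoritySign blk κ X i = 1 ↔ κ i + 2 ≤ Finset.card {j | blk j = i ∧ X j = 1} := by
  unfold majoritySign
  split_ifs with h1 h2
  · simp [h1]
  · simp [h1]
  · simp [h1]

lemma majoritySign_neg (hcard : ∀ i, Finset.card {j | blk j = i} ≤ 2 * κ i + 3)
    (X : J → SignType) : majoritySign blk κ (-X) = -majoritySign blk κ X := by
  have key : ∀ X : J → SignType, ∀ i, majoritySign blk κ X i = -1 ↔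
      majoritySign blk κ (-X) i = 1 := by
    intro X i
    rw [majoritySign_eq_neg_one_iff hcard, majoritySign_eq_one_iff]
    have : ∀ j, (-X) j = 1 ↔ X j = -1 := fun j => by
      simp only [Pi.neg_apply]; cases X j <;> decide
    simp only [this]
  funext i
  have h1 := key X i
  have h2 := key (-X) i
  rw [neg_neg] at h2
  simp only [Pi.neg_apply]
  revert h1 h2
  cases majoritySign blk κ X i <;> cases majoritySign blk κ (-X) i <;> decide

lemma majoritySign_mono (hcard : ∀ i, Finset.card {j | blk j = i} ≤ 2 * κ i + 3)
    {X Y : J → SignType} (h : ∀ j, X j ≠ 0 → Y j = X j) (i : Fin r)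
    (hi : majoritySign blk κ X i ≠ 0) : majoritySign blk κ Y i = majoritySign blk κ X i := by
  have hc : ∀ s : SignType, s ≠ 0 → Finset.card {j | blk j = i ∧ X j = s} ≤
      Finset.card {j | blk j = i ∧ Y j = s} := by
    intro s hs
    refine Finset.card_le_card fun j => ?_
    simp only [Finset.mem_filter, Finset.mem_univ, true_and]
    rintro ⟨h1, h2⟩
    exact ⟨h1, by rw [h j (h2 ▸ hs), h2]⟩
  rcases hX : majoritySign blk κ X i
  · exact absurd hX hi
  · exact (majoritySign_eq_neg_one_iff hcard Y i).2
      (((majoritySign_eq_neg_one_iff hcard X i).1 hX).trans (hc (-1) (by decide)))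
  · exact (majoritySign_eq_one_iff Y i).2
      (((majoritySign_eq_one_iff X i).1 hX).trans (hc 1 (by decide)))

/-- A linear van Kampen–Flores inequality for joins of skeleta, in Gale dual form. -/
lemma card_le_finrank_add {W : Type*} [AddCommGroup W] [Module ℝ W] [FiniteDimensional ℝ W]
    [Nonempty J] (hr : 1 ≤ r) (hcard : ∀ i, Finset.card {j | blk j = i} ≤ 2 * κ i + 3)
    (μ : J → W →ₗ[ℝ] ℝ)
    (hμ : ∀ X : J → SignType, (∀ i, Finset.card {j | blk j = i ∧ X j = -1} ≤ κ i + 1) →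
      (signCone μ X).Nonempty) :
    Fintype.card J ≤ Module.finrank ℝ W + (r - 1) := by
  classical
  let S : (Fin r → ℝ) →ₗ[ℝ] ℝ := ∑ i, LinearMap.proj i
  have hS : ∀ y, S y = ∑ i, y i := fun y => by simp [S, LinearMap.sum_apply]
  have hrank : Module.finrank ℝ (LinearMap.ker S) = r - 1 := by
    have h1 := LinearMap.finrank_range_add_finrank_ker S
    have h2 : LinearMap.range S = ⊤ := LinearMap.range_eq_top.2 (by
      intro x
      refine ⟨Pi.single ⟨0, hr⟩ x, ?_⟩
      rw [hS]; simp)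
    rw [h2, finrank_top] at h1
    simp at h1
    omega
  let ν : Fin r → LinearMap.ker S →ₗ[ℝ] ℝ := fun i => (LinearMap.proj i).comp (Submodule.subtype _)
  have hneg : ∀ X : J → SignType, (signCone μ X).Nonempty → (signCone μ (-X)).Nonempty := by
    rintro X ⟨w, hw⟩
    exact ⟨-w, by rw [signCone_neg]; simpa using hw⟩
  have hmaj : ∀ X, ¬ (signCone μ X).Nonempty → ∃ i, majoritySign blk κ X i = -1 := by
    intro X hX
    by_contra h
    push Not at h
    refine hX (hμ X fun i => ?_)
    have := (majoritySign_eq_neg_one_iff hcard X i).not.1 (h i)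
    omega
  have hmaj' : ∀ X, ¬ (signCone μ X).Nonempty → ∃ i, majoritySign blk κ X i = 1 := by
    intro X hX
    obtain ⟨i, hi⟩ := hmaj (-X) (fun h => hX (by simpa using hneg _ h))
    refine ⟨i, ?_⟩
    rw [majoritySign_neg hcard] at hi
    simpa [neg_eq_iff_eq_neg] using hi
  have hν : ∀ X, ¬ (signCone μ X).Nonempty → (signCone ν (majoritySign blk κ X)).Nonempty := by
    intro X hX
    obtain ⟨i, hi⟩ := hmaj X hX
    obtain ⟨j, hj⟩ := hmaj' X hX
    set b := majoritySign blk κ X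
    set p : ℕ := Finset.card {i | b i = 1} with hp
    set q : ℕ := Finset.card {i | b i = -1} with hq
    have hp0 : 0 < p := Finset.card_pos.2 ⟨j, by simpa using hj⟩
    have hq0 : 0 < q := Finset.card_pos.2 ⟨i, by simpa using hi⟩
    let y : Fin r → ℝ := fun i => (if b i = 1 then (q : ℝ) else 0) - if b i = -1 then (p : ℝ) else 0
    refine ⟨⟨y, ?_⟩, ?_⟩
    · rw [LinearMap.mem_ker, hS]
      simp only [y, Finset.sum_sub_distrib, ← Finset.sum_filter, Finset.sum_const, ← hp, ← hq,
        nsmul_eq_mul]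
      ring
    · intro l hl
      have : ν l ⟨y, by
        rw [LinearMap.mem_ker, hS]
        simp only [y, Finset.sum_sub_distrib, ← Finset.sum_filter, Finset.sum_const, ← hp, ← hq,
          nsmul_eq_mul]
        ring⟩ = y l := rfl
      rw [this]
      simp only [y]
      rcases hb : b l
      · exact absurd hb hl
      · simp [hp0]
      · simp [hq0]
  have hb0 : ∀ X, ¬ (signCone μ X).Nonempty → majoritySign blk κ X ≠ 0 := by
    intro X hX h
    obtain ⟨i, hi⟩ := hmaj X hX
    rw [h] at hi
    exact absurd (show (0 : SignType) = -1 from hi) (by decide)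
  let lev : (J → SignType) → ℕ := fun X =>
    if (signCone μ X).Nonempty then flagLevel (signCone μ X)
    else Module.finrank ℝ W + flagLevel (signCone ν (majoritySign blk κ X))
  let s : (J → SignType) → Bool := fun X =>
    if (signCone μ X).Nonempty then flagSign (signCone μ X)
    else flagSign (signCone ν (majoritySign blk κ X))
  have hs : ∀ X, X ≠ 0 → s (-X) = !s X := by
    intro X hX0
    have hiff : (signCone μ (-X)).Nonempty ↔ (signCone μ X).Nonempty :=
      ⟨fun h => by simpa using hneg _ h, hneg X⟩
    by_cases h : (signCone μ X).Nonempty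
    · simp only [s, if_pos h, if_pos (hiff.2 h)]
      rw [signCone_neg, flagSign_neg (convex_signCone μ X) h (zero_notMem_signCone μ hX0)]
    · simp only [s, if_neg h, if_neg (hiff.not.2 h)]
      rw [majoritySign_neg hcard, signCone_neg, flagSign_neg (convex_signCone ν _) (hν X h)
        (zero_notMem_signCone ν (hb0 X h))]
  have hpos : ∀ X, X ≠ 0 → 1 ≤ lev X := by
    intro X hX0
    by_cases h : (signCone μ X).Nonempty
    · simp only [lev, if_pos h]
      exact one_le_flagLevel h (zero_notMem_signCone μ hX0)
    · simp only [lev, if_neg h]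
      have := one_le_flagLevel (hν X h) (zero_notMem_signCone ν (hb0 X h))
      omega
  have hmono : ∀ X Y : J → SignType, X ≠ 0 → (∀ j, X j ≠ 0 → Y j = X j) →
      lev X < lev Y ∨ (lev X = lev Y ∧ s X = s Y) := by
    intro X Y hX0 hXY
    by_cases hY : (signCone μ Y).Nonempty
    · have hX := hY.mono (signCone_anti μ hXY)
      simp only [lev, s, if_pos hX, if_pos hY]
      exact flagLevel_lt_or_eq_of_subset (convex_signCone μ X) (convex_signCone μ Y)
        (zero_notMem_signCone μ hX0) hY (signCone_anti μ hXY)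
    · by_cases hX : (signCone μ X).Nonempty
      · simp only [lev, s, if_pos hX, if_neg hY]
        have := one_le_flagLevel (hν Y hY) (zero_notMem_signCone ν (hb0 Y hY))
        have := flagLevel_le_finrank hX
        left
        omega
      · simp only [lev, s, if_neg hX, if_neg hY]
        rcases flagLevel_lt_or_eq_of_subset (convex_signCone ν (majoritySign blk κ X))
          (convex_signCone ν (majoritySign blk κ Y)) (zero_notMem_signCone ν (hb0 X hX)) (hν Y hY)
          (signCone_anti ν (majoritySign_mono hcard hXY)) with h | ⟨h1, h2⟩
        · exact Or.inl (Nat.add_lt_add_left h _)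
        · exact Or.inr ⟨by rw [h1], h2⟩
  obtain ⟨X, hX0, hX⟩ := exists_card_le_level hs hpos hmono
  by_cases h : (signCone μ X).Nonempty
  · simp only [lev, if_pos h] at hX
    have := flagLevel_le_finrank h
    omega
  · simp only [lev, if_neg h] at hX
    have := flagLevel_le_finrank (hν X h)
    omega

end Majority

section Faces

variable {E : Type*} [AddCommGroup E] [Module ℝ E] {E' : Type*} [AddCommGroup E'] [Module ℝ E']

lemma IsFace.subset {P F : Set E} (h : IsFace P F) : F ⊆ P := by
  obtain ⟨_, c, rfl⟩ := h
  exact fun x hx => hx.1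

lemma IsFace.inter {P F G : Set E} (hF : IsFace P F) (hG : IsFace P G) (h : (F ∩ G).Nonempty) :
    IsFace P (F ∩ G) := by
  refine ⟨h, ?_⟩
  obtain ⟨_, c, rfl⟩ := hF
  obtain ⟨_, d, rfl⟩ := hG
  obtain ⟨z, ⟨hz, hzc⟩, _, hzd⟩ := h
  refine ⟨c + d, ?_⟩
  ext x
  constructor
  · rintro ⟨⟨hx, h1⟩, _, h2⟩
    exact ⟨hx, fun y hy => add_le_add (h1 y hy) (h2 y hy)⟩
  · rintro ⟨hx, h1⟩
    have h2 := h1 z hz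
    simp only [LinearMap.add_apply] at h2
    have h3 := hzc x hx
    have h4 := hzd x hx
    exact ⟨⟨hx, fun y hy => (hzc y hy).trans (by linarith)⟩,
      ⟨hx, fun y hy => (hzd y hy).trans (by linarith)⟩⟩

lemma IsFace.inter_preimage {Q : Set E} {G : Set E'} {f : E →ₗ[ℝ] E'} (hG : IsFace (f '' Q) G) :
    IsFace Q (Q ∩ f ⁻¹' G) := by
  obtain ⟨⟨z, hz⟩, c, rfl⟩ := hG
  obtain ⟨⟨x, hx, rfl⟩, _⟩ := id hz
  refine ⟨⟨x, hx, hz⟩, c.comp f, ?_⟩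
  ext y
  simp only [Set.mem_inter_iff, Set.mem_preimage, Set.mem_ofPred_eq, Set.forall_mem_image,
    LinearMap.comp_apply]
  exact ⟨fun h => ⟨h.1, h.2.2⟩, fun h => ⟨h.1, ⟨y, h.1, rfl⟩, h.2⟩⟩

lemma image_inter_preimage_of_subset {Q : Set E} {G : Set E'} {f : E →ₗ[ℝ] E'} (h : G ⊆ f '' Q) :
    f '' (Q ∩ f ⁻¹' G) = G := by
  rw [Set.image_inter_preimage, Set.inter_eq_right.2 h]

lemma polyDim_lt_of_ssubset [FiniteDimensional ℝ E] {P F G : Set E} (hF : IsFace P F) (hG : G ⊆ P)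
    (hFG : F ⊂ G) : polyDim F < polyDim G := by
  have hle : affineSpan ℝ F ≤ affineSpan ℝ G := affineSpan_mono ℝ hFG.1
  refine Submodule.finrank_lt_finrank_of_lt (lt_of_le_of_ne (AffineSubspace.direction_le hle) ?_)
  intro heq
  obtain ⟨⟨z, hz⟩, c, hc⟩ := id hF
  have hspan : affineSpan ℝ F = affineSpan ℝ G :=
    AffineSubspace.eq_of_direction_eq_of_nonempty_of_le heq ⟨z, subset_affineSpan ℝ F hz⟩ hle
  refine hFG.2 fun x hx => ?_
  have hxF : x ∈ affineSpan ℝ F := hspan ▸ subset_affineSpan ℝ G hx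
  have hcz : ∀ y ∈ affineSpan ℝ F, c y = c z := by
    intro y hy
    refine affineSpan_induction (p := fun y => c y = c z) hy ?_ ?_
    · intro w hw
      rw [hc] at hw hz
      exact le_antisymm (hz.2 w hw.1) (hw.2 z hz.1)
    · intro t u v w hu hv hw
      simp only [vsub_eq_sub, vadd_eq_add, map_add, map_smul, map_sub, hu, hv, hw]
      simp
  rw [hc] at hz ⊢
  exact ⟨hG hx, fun y hy => (hz.2 y hy).trans (hcz x hxF).ge⟩

lemma le_of_mem_convexHull {V : Set E} (g : E →ₗ[ℝ] ℝ) {m : ℝ} (h : ∀ v ∈ V, g v ≤ m) {x : E}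
    (hx : x ∈ convexHull ℝ V) : g x ≤ m :=
  convexHull_min (t := {x | g x ≤ m}) h (convex_halfSpace_le g.isLinear m) hx

lemma exists_isFace_max_on_face {Q F : Set E} (hQ : IsPolytope Q) (hF : IsFace Q F)
    (d : E →ₗ[ℝ] ℝ) : IsFace Q {x ∈ F | ∀ y ∈ F, d y ≤ d x} := by
  classical
  obtain ⟨V, rfl⟩ := hQ
  obtain ⟨⟨z, hz⟩, c, rfl⟩ := hF
  have hne : ∃ v ∈ V, c z ≤ c v := by
    by_contra! hlt
    have hV : V.Nonempty := by
      by_contra h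
      rw [Finset.not_nonempty_iff_eq_empty] at h
      subst h
      simpa using hz.1
    obtain ⟨v, hv, hmax⟩ := V.exists_max_image c hV
    exact absurd (le_of_mem_convexHull c (fun w hw => hmax w hw) hz.1) (not_le.2 (hlt v hv))
  obtain ⟨v₁, hv₁, hzv₁⟩ := hne
  obtain ⟨v₀, hv₀, hmax⟩ := (V.filter fun v => c z ≤ c v).exists_max_image d
    ⟨v₁, Finset.mem_filter.2 ⟨hv₁, hzv₁⟩⟩
  rw [Finset.mem_filter] at hv₀
  have hc : ∀ x ∈ convexHull ℝ (V : Set E), c x ≤ c z := hz.2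
  have hv₀Q : v₀ ∈ convexHull ℝ (V : Set E) := subset_convexHull ℝ _ hv₀.1
  have hcv₀ : c v₀ = c z := le_antisymm (hc _ hv₀Q) hv₀.2
  obtain ⟨K, hK0, hK⟩ : ∃ K : ℝ, 0 ≤ K ∧ ∀ v ∈ V, K * c v + d v ≤ K * c z + d v₀ := by
    have hb : ∀ v ∈ V, ∃ k : ℝ, 0 ≤ k ∧ ∀ K, k ≤ K → K * c v + d v ≤ K * c z + d v₀ := by
      intro v hv
      by_cases h : c z ≤ c v
      · refine ⟨0, le_rfl, fun K hK => ?_⟩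
        have h1 := hmax v (Finset.mem_filter.2 ⟨hv, h⟩)
        have h2 := mul_le_mul_of_nonneg_left (hc v (subset_convexHull ℝ _ hv)) hK
        linarith
      · have hpos : 0 < c z - c v := by linarith
        refine ⟨|d v - d v₀| / (c z - c v), by positivity, fun K hK => ?_⟩
        rw [div_le_iff₀ hpos] at hK
        have := le_abs_self (d v - d v₀)
        linarith
    choose! k hk0 hk using hb
    refine ⟨∑ v ∈ V, k v, Finset.sum_nonneg hk0, fun v hv => hk v hv _ ?_⟩
    exact Finset.single_le_sum hk0 hv
  have hKQ : ∀ x ∈ convexHull ℝ (V : Set E), K * c x + d x ≤ K * c z + d v₀ := fun x hx =>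
    le_of_mem_convexHull (K • c + d) (by simpa using hK) hx
  have hdF : ∀ x ∈ convexHull ℝ (V : Set E), c x = c z → d x ≤ d v₀ := by
    intro x hx h
    have := hKQ x hx
    rw [h] at this
    linarith
  have hmem : ∀ x ∈ convexHull ℝ (V : Set E),
      (∀ y ∈ convexHull ℝ (V : Set E), c y ≤ c x) ↔ c x = c z := fun x hx =>
    ⟨fun h => le_antisymm (hc x hx) (h z hz.1), fun h y hy => (hc y hy).trans h.ge⟩
  refine ⟨⟨v₀, ⟨hv₀Q, (hmem v₀ hv₀Q).2 hcv₀⟩, fun y hy => hdF y hy.1 ((hmem y hy.1).1 hy.2)⟩,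
    (K + 1) • c + d, ?_⟩
  ext x
  simp only [LinearMap.add_apply, LinearMap.smul_apply, smul_eq_mul]
  constructor
  · rintro ⟨⟨hx, h1⟩, h2⟩
    refine ⟨hx, fun y hy => ?_⟩
    have h3 := h2 v₀ ⟨hv₀Q, (hmem v₀ hv₀Q).2 hcv₀⟩
    have h4 := hKQ y hy
    have h5 := hc y hy
    rw [(hmem x hx).1 h1]
    linarith
  · rintro ⟨hx, h1⟩
    have h2 := h1 v₀ hv₀Q
    have h3 := hKQ x hx
    have h4 := hc x hx
    have h5 : c x = c z := by rw [hcv₀] at h2; linarith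
    refine ⟨⟨hx, (hmem x hx).2 h5⟩, fun y hy => ?_⟩
    have h6 := hdF y hy.1 ((hmem y hy.1).1 hy.2)
    rw [hcv₀, h5] at h2
    linarith

lemma eq_on_minimal_face {Q F : Set E} (hQ : IsPolytope Q) (hF : IsFace Q F)
    (hmin : ∀ G, IsFace Q G → G ⊆ F → G = F) (d : E →ₗ[ℝ] ℝ) {x y : E} (hx : x ∈ F) (hy : y ∈ F) :
    d x = d y := by
  have h := hmin _ (exists_isFace_max_on_face hQ hF d) fun x hx => hx.1
  rw [← h] at hx hy
  exact le_antisymm (hy.2 x hx.1) (hx.2 y hy.1)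

end Faces

/-- The nonempty faces of a product of simplices, encoded by tuples of nonempty vertex sets. -/
abbrev Box {r : ℕ} (n : Fin r → ℕ) : Type :=
  {A : (i : Fin r) → Finset (Fin (n i + 1)) // ∀ i, (A i).Nonempty}

namespace Box

variable {r : ℕ} {n : Fin r → ℕ}

/-- The dimension of the face encoded by a box. -/
def dim (A : Box n) : ℕ := ∑ i, ((A.1 i).card - 1)

/-- The box of a vertex. -/
def single (a : (i : Fin r) → Fin (n i + 1)) : Box n := ⟨fun i => {a i}, fun _ => by simp⟩

/-- The box of the facet opposite to the vertex `j` of the `i`-th simplex. -/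
def facet (hn : ∀ i, 1 ≤ n i) (i : Fin r) (j : Fin (n i + 1)) : Box n :=
  ⟨Function.update (fun _ => Finset.univ) i {j}ᶜ, fun i' => by
    rcases eq_or_ne i' i with rfl | h
    · rw [Function.update_self, ← Finset.card_pos, Finset.card_compl]
      have := hn i'
      simp; omega
    · rw [Function.update_of_ne h]; exact Finset.univ_nonempty⟩

lemma single_le_iff {a : (i : Fin r) → Fin (n i + 1)} {A : Box n} :
    single a ≤ A ↔ ∀ i, a i ∈ A.1 i := by
  simp [single, ← Subtype.coe_le_coe, Pi.le_def]

lemma single_le_facet_iff {hn : ∀ i, 1 ≤ n i} {a : (i : Fin r) → Fin (n i + 1)} {i : Fin r}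
    {j : Fin (n i + 1)} : single a ≤ facet hn i j ↔ a i ≠ j := by
  rw [single_le_iff]
  constructor
  · intro h
    simpa [facet] using h i
  · intro h i'
    rcases eq_or_ne i' i with rfl | h'
    · simpa [facet] using h
    · simp [facet, h']

lemma le_single {a : (i : Fin r) → Fin (n i + 1)} {A : Box n} (h : A ≤ single a) :
    A = single a := by
  refine Subtype.ext (funext fun i => ?_)
  exact (Finset.Nonempty.subset_singleton_iff (A.2 i)).1 (h i)

lemma exists_single_le (A : Box n) : ∃ a, single a ≤ A := by
  choose a ha using A.2
  exact ⟨a, single_le_iff.2 ha⟩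

end Box

section ProductPolytope

variable {E : Type*} [AddCommGroup E] [Module ℝ E] {r : ℕ} {n : Fin r → ℕ} {Q : Set E}
  (Ψ : Box n ≃o facesOf Q)

lemma isFace_box (A : Box n) : IsFace Q (Ψ A : Set E) := (Ψ A).2

/-- A point of the minimal face that corresponds to the vertex `a`. -/
noncomputable def boxPoint (a : (i : Fin r) → Fin (n i + 1)) : E :=
  (isFace_box Ψ (Box.single a)).1.some

lemma boxPoint_mem_single (a : (i : Fin r) → Fin (n i + 1)) :
    boxPoint Ψ a ∈ (Ψ (Box.single a) : Set E) :=
  (isFace_box Ψ (Box.single a)).1.some_mem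

lemma boxPoint_mem (a : (i : Fin r) → Fin (n i + 1)) : boxPoint Ψ a ∈ Q :=
  (isFace_box Ψ _).subset (boxPoint_mem_single Ψ a)

lemma exists_box_eq {G : Set E} (hG : IsFace Q G) : ∃ B, (Ψ B : Set E) = G :=
  ⟨Ψ.symm ⟨G, hG⟩, by simp⟩

lemma box_subset_iff {A B : Box n} : (Ψ A : Set E) ⊆ Ψ B ↔ A ≤ B := Ψ.le_iff_le

lemma boxPoint_mem_iff {a : (i : Fin r) → Fin (n i + 1)} {A : Box n} :
    boxPoint Ψ a ∈ (Ψ A : Set E) ↔ Box.single a ≤ A := by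
  refine ⟨fun h => ?_, fun h => (box_subset_iff Ψ).2 h (boxPoint_mem_single Ψ a)⟩
  obtain ⟨B, hB⟩ := exists_box_eq Ψ ((isFace_box Ψ A).inter (isFace_box Ψ (Box.single a))
    ⟨_, h, boxPoint_mem_single Ψ a⟩)
  have h1 : B ≤ Box.single a := (box_subset_iff Ψ).1 (hB ▸ Set.inter_subset_right)
  have h2 : B ≤ A := (box_subset_iff Ψ).1 (hB ▸ Set.inter_subset_left)
  exact Box.le_single h1 ▸ h2

lemma eq_on_single (hQ : IsPolytope Q) (a : (i : Fin r) → Fin (n i + 1)) (d : E →ₗ[ℝ] ℝ) {x y : E}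
    (hx : x ∈ (Ψ (Box.single a) : Set E)) (hy : y ∈ (Ψ (Box.single a) : Set E)) : d x = d y := by
  refine eq_on_minimal_face hQ (isFace_box Ψ _) (fun G hG hsub => ?_) d hx hy
  obtain ⟨B, rfl⟩ := exists_box_eq Ψ hG
  rw [Box.le_single ((box_subset_iff Ψ).1 hsub)]

/-- The edge vector at the vertex `a` towards the vertex whose `i`-th coordinate is `j`. -/
noncomputable def boxEdge (a : (i : Fin r) → Fin (n i + 1)) (i : Fin r) (j : Fin (n i + 1)) : E :=
  boxPoint Ψ (Function.update a i j) - boxPoint Ψ a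

lemma le_of_vanish_on_edges (hQ : IsPolytope Q) (a : (i : Fin r) → Fin (n i + 1)) (d : E →ₗ[ℝ] ℝ)
    (hd : ∀ i j, j ≠ a i → d (boxEdge Ψ a i j) = 0) {w : E} (hw : w ∈ Q) :
    d w ≤ d (boxPoint Ψ a) := by
  classical
  by_contra! hlt
  set p := boxPoint Ψ a with hp
  obtain ⟨c, hc⟩ := (isFace_box Ψ (Box.single a)).2
  have hpc : ∀ x ∈ Q, c x ≤ c p := by
    have := boxPoint_mem_single Ψ a
    rw [hc] at this
    exact this.2
  have hmem : ∀ x ∈ Q, c p ≤ c x → x ∈ (Ψ (Box.single a) : Set E) := fun x hx h => by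
    rw [hc]; exact ⟨hx, fun y hy => (hpc y hy).trans h⟩
  obtain ⟨V, hV⟩ := id hQ
  have hVQ : ∀ v ∈ V, v ∈ Q := fun v hv => hV ▸ subset_convexHull ℝ _ hv
  have hne : (V.filter fun v => d p < d v).Nonempty := by
    by_contra h
    rw [Finset.not_nonempty_iff_eq_empty, Finset.filter_eq_empty_iff] at h
    exact absurd (le_of_mem_convexHull d (fun v hv => not_lt.1 (h hv)) (hV ▸ hw)) (not_le.2 hlt)
  obtain ⟨v, hv, hmin⟩ := Finset.exists_min_image _ (fun v => (c p - c v) / (d v - d p)) hne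
  rw [Finset.mem_filter] at hv
  have hvS : v ∉ (Ψ (Box.single a) : Set E) := fun h =>
    hv.2.ne' (eq_on_single Ψ hQ a d h (boxPoint_mem_single Ψ a))
  have hcv : c v < c p := by
    by_contra! h
    exact hvS (hmem v (hVQ v hv.1) h)
  set t := (c p - c v) / (d v - d p) with ht
  have ht0 : 0 < t := div_pos (by linarith) (by linarith [hv.2])
  have hg : ∀ x ∈ Q, (c + t • d) x ≤ (c + t • d) p := by
    intro x hx
    refine le_of_mem_convexHull _ (fun u hu => ?_) (hV ▸ hx)
    have hu' : u ∈ V := hu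
    simp only [LinearMap.add_apply, LinearMap.smul_apply, smul_eq_mul]
    by_cases h : d p < d u
    · have := hmin u (Finset.mem_filter.2 ⟨hu', h⟩)
      rw [le_div_iff₀ (by linarith)] at this
      linarith
    · have h1 := hpc u (hVQ u hu')
      have h2 := mul_le_mul_of_nonneg_left (not_lt.1 h) ht0.le
      linarith
  obtain ⟨B, hB⟩ := exists_box_eq Ψ (G := {x ∈ Q | ∀ y ∈ Q, (c + t • d) y ≤ (c + t • d) x})
    ⟨⟨p, boxPoint_mem Ψ a, hg⟩, _, rfl⟩
  have haB : Box.single a ≤ B := by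
    rw [← boxPoint_mem_iff Ψ, hB]
    exact ⟨boxPoint_mem Ψ a, hg⟩
  have hvB : v ∈ (Ψ B : Set E) := by
    rw [hB]
    refine ⟨hVQ v hv.1, fun y hy => (hg y hy).trans ?_⟩
    simp only [LinearMap.add_apply, LinearMap.smul_apply, smul_eq_mul]
    have : t * (d v - d p) = c p - c v := div_mul_cancel₀ _ (by linarith [hv.2])
    linarith
  have hBS : B ≠ Box.single a := by rintro rfl; exact hvS hvB
  obtain ⟨i, j, hj, hja⟩ : ∃ i, ∃ j ∈ B.1 i, j ≠ a i := by
    by_contra! h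
    refine hBS (Box.le_single fun i j hj => ?_)
    simpa [Box.single] using h i j hj
  have hup : boxPoint Ψ (Function.update a i j) ∈ (Ψ B : Set E) := by
    rw [boxPoint_mem_iff, Box.single_le_iff]
    intro i'
    rcases eq_or_ne i' i with rfl | h
    · simpa using hj
    · simpa [h] using Box.single_le_iff.1 haB i'
  have h1 := hd i j hja
  rw [boxEdge, map_sub, sub_eq_zero] at h1
  rw [hB] at hup
  have h2 := hup.2 p (boxPoint_mem Ψ a)
  simp only [LinearMap.add_apply, LinearMap.smul_apply, smul_eq_mul, h1] at h2
  have h3 := (boxPoint_mem_iff Ψ).1 (hmem _ hup.1 (by linarith))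
  have h4 := Box.single_le_iff.1 h3 i
  simp [Box.single, hja] at h4

lemma eq_of_vanish_on_edges (hQ : IsPolytope Q) (a : (i : Fin r) → Fin (n i + 1)) (d : E →ₗ[ℝ] ℝ)
    (hd : ∀ i j, j ≠ a i → d (boxEdge Ψ a i j) = 0) {w : E} (hw : w ∈ Q) :
    d w = d (boxPoint Ψ a) := by
  refine le_antisymm (le_of_vanish_on_edges Ψ hQ a d hd hw) ?_
  have := le_of_vanish_on_edges Ψ hQ a (-d) (fun i j h => by simp [hd i j h]) hw
  simpa using this

variable (hn : ∀ i, 1 ≤ n i)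

/-- A linear functional that is maximal on `Q` exactly on a facet. -/
noncomputable def facetFunctional (i : Fin r) (j : Fin (n i + 1)) : E →ₗ[ℝ] ℝ :=
  (isFace_box Ψ (Box.facet hn i j)).2.choose

lemma facetFunctional_spec (i : Fin r) (j : Fin (n i + 1)) :
    (Ψ (Box.facet hn i j) : Set E) =
      {x ∈ Q | ∀ y ∈ Q, facetFunctional Ψ hn i j y ≤ facetFunctional Ψ hn i j x} :=
  (isFace_box Ψ (Box.facet hn i j)).2.choose_spec

lemma facetFunctional_edge_eq_zero (a : (i : Fin r) → Fin (n i + 1)) {i i' : Fin r}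
    {j : Fin (n i + 1)} {j' : Fin (n i' + 1)} (ha : a i' ≠ j')
    (hu : Function.update a i j i' ≠ j') :
    facetFunctional Ψ hn i' j' (boxEdge Ψ a i j) = 0 := by
  have h1 := (boxPoint_mem_iff Ψ).2 (Box.single_le_facet_iff (hn := hn).2 ha)
  have h2 := (boxPoint_mem_iff Ψ).2 (Box.single_le_facet_iff (hn := hn).2 hu)
  rw [facetFunctional_spec] at h1 h2
  rw [boxEdge, map_sub, sub_eq_zero]
  exact le_antisymm (h1.2 _ h2.1) (h2.2 _ h1.1)

lemma facetFunctional_edge_neg (a : (i : Fin r) → Fin (n i + 1)) {i : Fin r}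
    {j : Fin (n i + 1)} (hj : j ≠ a i) : facetFunctional Ψ hn i j (boxEdge Ψ a i j) < 0 := by
  have h1 := (boxPoint_mem_iff Ψ).2 (Box.single_le_facet_iff (hn := hn).2 hj.symm)
  have h2 := (boxPoint_mem_iff Ψ (a := Function.update a i j)).not.2
    (Box.single_le_facet_iff (hn := hn) (i := i) (j := j).not.2 (by simp))
  rw [facetFunctional_spec] at h1 h2
  rw [boxEdge, map_sub, sub_neg]
  by_contra! h
  exact h2 ⟨boxPoint_mem Ψ _, fun y hy => (h1.2 y hy).trans h⟩

lemma facetFunctional_edge_of_ne (a : (i : Fin r) → Fin (n i + 1)) {i i' : Fin r}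
    {j : Fin (n i + 1)} {j' : Fin (n i' + 1)} (hj' : j' ≠ a i')
    (hne : (⟨i', j'⟩ : (i : Fin r) × Fin (n i + 1)) ≠ ⟨i, j⟩) :
    facetFunctional Ψ hn i' j' (boxEdge Ψ a i j) = 0 := by
  refine facetFunctional_edge_eq_zero Ψ hn a hj'.symm ?_
  rcases eq_or_ne i' i with rfl | h
  · rw [Function.update_self]
    rintro rfl
    exact hne rfl
  · rw [Function.update_of_ne h]; exact hj'.symm

/-- The coefficients of a functional `d` in the facet functionals at the vertex `a`. -/
noncomputable def facetCoeff (a : (i : Fin r) → Fin (n i + 1)) (d : E →ₗ[ℝ] ℝ) (i : Fin r)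
    (j : Fin (n i + 1)) : ℝ :=
  if j = a i then 0 else d (boxEdge Ψ a i j) / facetFunctional Ψ hn i j (boxEdge Ψ a i j)

lemma sum_coeff_edge (a : (i : Fin r) → Fin (n i + 1)) (μ : (i : Fin r) → Fin (n i + 1) → ℝ)
    {i : Fin r} {j : Fin (n i + 1)} (hj : j ≠ a i) :
    ∑ i', ∑ j', μ i' j' * facetFunctional Ψ hn i' j' (boxEdge Ψ a i j) =
      ∑ i', μ i' (a i') * facetFunctional Ψ hn i' (a i') (boxEdge Ψ a i j) +
        μ i j * facetFunctional Ψ hn i j (boxEdge Ψ a i j) := by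
  have h1 : ∀ i', ∑ j', μ i' j' * facetFunctional Ψ hn i' j' (boxEdge Ψ a i j) =
      μ i' (a i') * facetFunctional Ψ hn i' (a i') (boxEdge Ψ a i j) +
        if i' = i then μ i j * facetFunctional Ψ hn i j (boxEdge Ψ a i j) else 0 := by
    intro i'
    rw [← Finset.add_sum_erase _ _ (Finset.mem_univ (a i'))]
    congr 1
    split_ifs with h
    · subst h
      refine Finset.sum_eq_single j (fun j' hj' hne => ?_) (fun h => ?_)
      · rw [facetFunctional_edge_of_ne Ψ hn a (Finset.ne_of_mem_erase hj') (by simpa using hne),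
          mul_zero]
      · simp [hj] at h
    · refine Finset.sum_eq_zero fun j' hj' => ?_
      rw [facetFunctional_edge_of_ne Ψ hn a (Finset.ne_of_mem_erase hj') ?_, mul_zero]
      intro h'
      exact h (congrArg Sigma.fst h')
  simp [h1, Finset.sum_add_distrib]

lemma eq_sum_facetCoeff (hQ : IsPolytope Q) (a : (i : Fin r) → Fin (n i + 1)) (d : E →ₗ[ℝ] ℝ)
    {x y : E} (hx : x ∈ Q) (hy : y ∈ Q) :
    d (x - y) = ∑ i, ∑ j, facetCoeff Ψ hn a d i j * facetFunctional Ψ hn i j (x - y) := by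
  set d' : E →ₗ[ℝ] ℝ := d - ∑ i, ∑ j, facetCoeff Ψ hn a d i j • facetFunctional Ψ hn i j with hd'
  have happ : ∀ z, d' z = d z - ∑ i, ∑ j, facetCoeff Ψ hn a d i j * facetFunctional Ψ hn i j z := by
    intro z; simp [hd', LinearMap.sum_apply]
  have hvan : ∀ i j, j ≠ a i → d' (boxEdge Ψ a i j) = 0 := by
    intro i j hj
    rw [happ, sum_coeff_edge Ψ hn a _ hj]
    simp only [facetCoeff, if_true, if_neg hj, zero_mul, Finset.sum_const_zero, zero_add]
    rw [div_mul_cancel₀ _ (facetFunctional_edge_neg Ψ hn a hj).ne, sub_self]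
  have h1 := eq_of_vanish_on_edges Ψ hQ a d' hvan hx
  have h2 := eq_of_vanish_on_edges Ψ hQ a d' hvan hy
  have h3 : d' (x - y) = 0 := by rw [map_sub, h1, h2, sub_self]
  rw [happ] at h3
  linarith

end ProductPolytope

lemma exists_le_sum_eq {ι : Type*} [Fintype ι] (m : ι → ℕ) {k : ℕ} (hk : k ≤ ∑ i, m i) :
    ∃ κ : ι → ℕ, (∀ i, κ i ≤ m i) ∧ ∑ i, κ i = k := by
  classical
  induction k with
  | zero => exact ⟨0, by simp, by simp⟩
  | succ k ih =>
    obtain ⟨κ, hκ, hsum⟩ := ih (by omega)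
    obtain ⟨i, -, hi⟩ := Finset.exists_lt_of_sum_lt (s := Finset.univ) (f := κ) (g := m) (by omega)
    refine ⟨κ + Pi.single i 1, fun j => ?_, ?_⟩
    · rcases eq_or_ne j i with rfl | h
      · simpa using hi
      · simpa [h] using hκ j
    · simp [Finset.sum_add_distrib, hsum]

section DimensionBound

variable {E : Type*} [AddCommGroup E] [Module ℝ E] {E' : Type*} [AddCommGroup E'] [Module ℝ E']
  {r : ℕ} {n : Fin r → ℕ} {Q : Set E} (Ψ : Box n ≃o facesOf Q) (hn : ∀ i, 1 ≤ n i)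
  (f : E →ₗ[ℝ] E')

/-- The image of an edge vector, as a direction of the affine span of the projected polytope. -/
noncomputable def imageEdge (i : Fin r) (j : Fin (n i + 1)) : (affineSpan ℝ (f '' Q)).direction :=
  ⟨f (boxEdge Ψ (fun _ => 0) i j), by
    rw [boxEdge, map_sub]
    exact AffineSubspace.vsub_mem_direction
      (subset_affineSpan ℝ _ (Set.mem_image_of_mem f (boxPoint_mem Ψ _)))
      (subset_affineSpan ℝ _ (Set.mem_image_of_mem f (boxPoint_mem Ψ _)))⟩

/-- The functional reading off the facet coefficients of a functional on the projected polytope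
from its restriction and its coefficients at a base vertex. -/
noncomputable def coeffFunctional (i : Fin r) (j : Fin (n i + 1)) :
    (Module.Dual ℝ (affineSpan ℝ (f '' Q)).direction × (Fin r → ℝ)) →ₗ[ℝ] ℝ :=
  if j = 0 then (LinearMap.proj i).comp (LinearMap.snd ℝ _ _) else
    (facetFunctional Ψ hn i j (boxEdge Ψ (fun _ => 0) i j))⁻¹ •
      ((Module.Dual.eval ℝ _ (imageEdge Ψ f i j)).comp (LinearMap.fst ℝ _ _) -
        ∑ i', facetFunctional Ψ hn i' 0 (boxEdge Ψ (fun _ => 0) i j) •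
          (LinearMap.proj i').comp (LinearMap.snd ℝ _ _))

lemma coeffFunctional_apply (hQ : IsPolytope Q) (c : E' →ₗ[ℝ] ℝ)
    (a : (i : Fin r) → Fin (n i + 1)) (i : Fin r) (j : Fin (n i + 1)) :
    coeffFunctional Ψ hn f i j
      (c.comp (Submodule.subtype _), fun i => facetCoeff Ψ hn a (c.comp f) i 0) =
      facetCoeff Ψ hn a (c.comp f) i j := by
  rw [coeffFunctional]
  split_ifs with hj
  · subst hj
    simp
  · have hneg := facetFunctional_edge_neg Ψ hn (fun _ => 0) (i := i) (j := j) hj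
    have h := eq_sum_facetCoeff Ψ hn hQ a (c.comp f)
      (boxPoint_mem Ψ (Function.update (fun _ => 0) i j)) (boxPoint_mem Ψ fun _ => 0)
    rw [← boxEdge, sum_coeff_edge Ψ hn (fun _ => 0) _ hj] at h
    simp only [LinearMap.smul_apply, LinearMap.sub_apply, LinearMap.comp_apply, LinearMap.fst_apply,
      LinearMap.snd_apply, Module.Dual.eval_apply, LinearMap.sum_apply, LinearMap.proj_apply,
      smul_eq_mul, Submodule.subtype_apply, imageEdge]
    rw [LinearMap.comp_apply] at h
    rw [h, inv_mul_eq_iff_eq_mul₀ hneg.ne]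
    simp only [mul_comm]
    ring

lemma exists_coeffFunctional (hQ : IsPolytope Q) {A : Box n} {c : E' →ₗ[ℝ] ℝ}
    (hc : (Ψ A : Set E) = {x ∈ Q | ∀ y ∈ Q, c (f y) ≤ c (f x)}) :
    ∃ w, ∀ i j, (j ∈ A.1 i → coeffFunctional Ψ hn f i j w = 0) ∧
      (j ∉ A.1 i → 0 < coeffFunctional Ψ hn f i j w) := by
  obtain ⟨a, ha⟩ := A.exists_single_le
  refine ⟨(c.comp (Submodule.subtype _), fun i => facetCoeff Ψ hn a (c.comp f) i 0),
    fun i j => ?_⟩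
  rw [coeffFunctional_apply Ψ hn f hQ, facetCoeff]
  have haA := Box.single_le_iff.1 ha
  have h1 := (boxPoint_mem_iff Ψ).2 ha
  rw [hc] at h1
  split_ifs with hj
  · subst hj
    exact ⟨fun _ => rfl, fun h => absurd (haA i) h⟩
  · have hneg := facetFunctional_edge_neg Ψ hn a hj
    have h2 : boxPoint Ψ (Function.update a i j) ∈ (Ψ A : Set E) ↔ j ∈ A.1 i := by
      rw [boxPoint_mem_iff, Box.single_le_iff]
      refine ⟨fun h => by simpa using h i, fun h i' => ?_⟩
      rcases eq_or_ne i' i with rfl | h'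
      · simpa using h
      · simpa [h'] using haA i'
    rw [hc] at h2
    have h3 := h1.2 _ (boxPoint_mem Ψ (Function.update a i j))
    constructor
    · intro h
      have h4 := (h2.2 h).2 _ h1.1
      rw [boxEdge, map_sub, LinearMap.comp_apply, LinearMap.comp_apply, le_antisymm h3 h4,
        sub_self, zero_div]
    · intro h
      refine div_pos_of_neg_of_neg ?_ hneg
      rw [boxEdge, map_sub, LinearMap.comp_apply, LinearMap.comp_apply, sub_neg]
      by_contra! h4
      exact h (h2.1 ⟨boxPoint_mem Ψ _, fun y hy => (h1.2 y hy).trans h4⟩)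

lemma exists_sign_pattern (hQ : IsPolytope Q) (hn2 : ∀ i, 2 ≤ n i) {k : ℕ} {κ : Fin r → ℕ}
    (hκ : ∀ i, κ i ≤ (n i - 2) / 2) (hk : ∑ i, κ i = k)
    (hface : ∀ A : Box n, A.dim ≤ k →
      ∃ c : E' →ₗ[ℝ] ℝ, (Ψ A : Set E) = {x ∈ Q | ∀ y ∈ Q, c (f y) ≤ c (f x)})
    (N : (i : Fin r) → Finset (Fin (n i + 1))) (hN : ∀ i, (N i).card ≤ κ i + 1) :
    ∃ w, ∀ i j, (j ∈ N i → coeffFunctional Ψ hn f i j w < 0) ∧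
      (j ∉ N i → 0 < coeffFunctional Ψ hn f i j w) := by
  classical
  have hw : ∀ A : Box n, A.dim ≤ k → ∃ w, ∀ i j,
      (j ∈ A.1 i → coeffFunctional Ψ hn f i j w = 0) ∧
      (j ∉ A.1 i → 0 < coeffFunctional Ψ hn f i j w) := fun A hA =>
    (hface A hA).elim fun c hc => exists_coeffFunctional Ψ hn f hQ hc
  have hout : ∀ i, ∃ j, j ∉ N i := by
    intro i
    by_contra! h
    have h1 : N i = Finset.univ := Finset.eq_univ_iff_forall.2 h
    have h2 := hN i
    rw [h1, Finset.card_univ, Fintype.card_fin] at h2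
    have := hκ i
    have := hn2 i
    omega
  choose b hb using hout
  have key : ∀ a : (i : Fin r) → Fin (n i + 1), ∃ w, ∀ i j,
      (j ∈ (if (N i).Nonempty then N i else {a i}) → coeffFunctional Ψ hn f i j w = 0) ∧
      (j ∉ (if (N i).Nonempty then N i else {a i}) → 0 < coeffFunctional Ψ hn f i j w) := by
    intro a
    refine hw ⟨fun i => if (N i).Nonempty then N i else {a i}, fun i => ?_⟩ ?_
    · dsimp only
      split_ifs with h
      · exact h
      · simp
    · rw [Box.dim, ← hk]
      refine Finset.sum_le_sum fun i _ => ?_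
      have := hN i
      dsimp only
      split_ifs
      · omega
      · simp
  obtain ⟨w₁, h₁⟩ := key fun _ => 0
  obtain ⟨w₂, h₂⟩ := key fun i => Fin.last (n i)
  obtain ⟨w₃, h₃⟩ := hw (Box.single b) (by simp [Box.dim, Box.single])
  have hu : ∀ i j, (j ∈ N i → coeffFunctional Ψ hn f i j (w₁ + w₂) = 0) ∧
      (j ∉ N i → 0 < coeffFunctional Ψ hn f i j (w₁ + w₂)) := by
    intro i j
    have h1 := h₁ i j
    have h2 := h₂ i j
    rw [map_add]
    by_cases h : (N i).Nonempty
    · rw [if_pos h] at h1 h2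
      exact ⟨fun h => by rw [h1.1 h, h2.1 h, add_zero], fun h => add_pos (h1.2 h) (h2.2 h)⟩
    · rw [if_neg h, Finset.mem_singleton] at h1 h2
      refine ⟨fun h' => absurd ⟨j, h'⟩ h, fun _ => ?_⟩
      by_cases h0 : j = 0
      · rw [h1.1 h0, zero_add]
        refine h2.2 fun hl => ?_
        have := h0.symm.trans hl
        rw [Fin.ext_iff] at this
        have := hn i
        simp at *
        omega
      · refine add_pos_of_pos_of_nonneg (h1.2 h0) ?_
        by_cases hl : j = Fin.last (n i)
        · exact (h2.1 hl).ge
        · exact (h2.2 hl).le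
  have hK : ∀ i j, ∃ K₀ : ℝ, 0 ≤ K₀ ∧ (j ∉ N i → ∀ K, K₀ < K →
      coeffFunctional Ψ hn f i j w₃ < K * coeffFunctional Ψ hn f i j (w₁ + w₂)) := by
    intro i j
    by_cases h : j ∈ N i
    · exact ⟨0, le_rfl, fun h' => absurd h h'⟩
    · have hpos := (hu i j).2 h
      refine ⟨|coeffFunctional Ψ hn f i j w₃| / coeffFunctional Ψ hn f i j (w₁ + w₂),
        by positivity, fun _ K hK => ?_⟩
      rw [div_lt_iff₀ hpos] at hK
      exact (le_abs_self _).trans_lt hK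
  choose K₀ hK0 hK using hK
  set K : ℝ := ∑ i, ∑ j, K₀ i j + 1 with hKdef
  have hle : ∀ i j, K₀ i j < K := fun i j => by
    have h1 := Finset.single_le_sum (f := fun j => K₀ i j) (fun j _ => hK0 i j) (Finset.mem_univ j)
    have h2 := Finset.single_le_sum (f := fun i => ∑ j, K₀ i j)
      (fun i _ => Finset.sum_nonneg fun j _ => hK0 i j) (Finset.mem_univ i)
    linarith
  refine ⟨K • (w₁ + w₂) - w₃, fun i j => ?_⟩
  rw [map_sub, map_smul, smul_eq_mul]
  refine ⟨fun h => ?_, fun h => sub_pos.2 (hK i j h K (hle i j))⟩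
  rw [(hu i j).1 h, mul_zero, zero_sub, neg_lt_zero]
  refine (h₃ i j).2 fun h' => ?_
  simp only [Box.single, Finset.mem_singleton] at h'
  exact hb i (h' ▸ h)

theorem le_polyDim_image [FiniteDimensional ℝ E'] (hr : 1 ≤ r) (hQ : IsPolytope Q)
    (hn2 : ∀ i, 2 ≤ n i) {k : ℕ} (hk : k ≤ ∑ i, (n i - 2) / 2)
    (hface : ∀ A : Box n, A.dim ≤ k →
      ∃ c : E' →ₗ[ℝ] ℝ, (Ψ A : Set E) = {x ∈ Q | ∀ y ∈ Q, c (f y) ≤ c (f x)}) :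
    2 * k + r + 1 ≤ polyDim (f '' Q) := by
  classical
  have hn : ∀ i, 1 ≤ n i := fun i => one_le_two.trans (hn2 i)
  obtain ⟨κ, hκ, hsum⟩ := exists_le_sum_eq _ hk
  have hle : ∀ i, 2 * κ i + 3 ≤ n i + 1 := fun i => by
    have := hκ i
    have := hn2 i
    omega
  have : Nonempty ((i : Fin r) × Fin (2 * κ i + 3)) := ⟨⟨⟨0, hr⟩, 0⟩⟩
  have hfib : ∀ (i : Fin r) (p : (i : Fin r) × Fin (2 * κ i + 3) → Prop) [DecidablePred p],
      Finset.card {j | j.1 = i ∧ p j} =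
        (Finset.univ.filter fun l : Fin (2 * κ i + 3) => p ⟨i, l⟩).card := by
    intro i p _
    refine (Finset.card_bij (fun l _ => ⟨i, l⟩) ?_ ?_ ?_).symm
    · intro l hl
      simpa using hl
    · intro l _ l' _ h
      simpa using h
    · rintro ⟨i', l⟩ h
      simp only [Finset.mem_filter, Finset.mem_univ, true_and] at h
      obtain ⟨rfl, h⟩ := h
      exact ⟨l, by simpa using h, rfl⟩
  have hmain := card_le_finrank_add (blk := fun j : (i : Fin r) × Fin (2 * κ i + 3) => j.1) (κ := κ)
    hr (fun i => by simpa using (hfib i fun _ => True).le)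
    (fun j => coeffFunctional Ψ hn f j.1 (Fin.castLE (hle j.1) j.2)) (fun X hX => by
      obtain ⟨w, hw⟩ := exists_sign_pattern Ψ hn f hQ hn2 hκ hsum hface
        (fun i => (Finset.univ.filter fun l : Fin (2 * κ i + 3) => X ⟨i, l⟩ = -1).map
          (Fin.castLEEmb (hle i))) (fun i => by
            rw [Finset.card_map, ← hfib i fun j => X j = -1]
            exact hX i)
      refine ⟨w, fun j hj => ?_⟩
      obtain ⟨i, l⟩ := j
      have h := hw i (Fin.castLE (hle i) l)
      have hmem : Fin.castLE (hle i) l ∈ (Finset.univ.filter fun l : Fin (2 * κ i + 3) =>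
          X ⟨i, l⟩ = -1).map (Fin.castLEEmb (hle i)) ↔ X ⟨i, l⟩ = -1 := by
        simp
      rw [hmem] at h
      rcases hX' : X ⟨i, l⟩ with _ | _ | _
      · exact absurd hX' hj
      · have := h.1 hX'
        simpa using this
      · have := h.2 (by rw [hX']; decide)
        simpa using this)
  rw [Module.finrank_prod, Subspace.dual_finrank_eq, Module.finrank_fintype_fun_eq_card,
    Fintype.card_fin, Fintype.card_sigma] at hmain
  simp only [Fintype.card_fin, Finset.sum_add_distrib, ← Finset.mul_sum, hsum, Finset.sum_const,
    Finset.card_univ, smul_eq_mul] at hmain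
  rw [polyDim]
  omega

end DimensionBound

lemma Box.exists_lt_dim {r : ℕ} {n : Fin r → ℕ} {A : Box n} {m : ℕ} (h : A.dim = m + 1) :
    ∃ B < A, B.dim = m := by
  classical
  obtain ⟨i, hi⟩ : ∃ i, 1 < (A.1 i).card := by
    by_contra! hall
    have : A.dim = 0 := Finset.sum_eq_zero fun i _ => by have := hall i; omega
    omega
  obtain ⟨j, hj⟩ := A.2 i
  have hcard := Finset.card_erase_of_mem hj
  have hne : ((A.1 i).erase j).Nonempty := by rw [← Finset.card_pos]; omega
  refine ⟨⟨Function.update A.1 i ((A.1 i).erase j), fun i' => ?_⟩, ?_, ?_⟩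
  · rcases eq_or_ne i' i with rfl | h'
    · simpa using hne
    · simpa [h'] using A.2 i'
  · rw [← Subtype.coe_lt_coe]
    exact update_lt_self_iff.2 (Finset.erase_ssubset hj)
  · rw [Box.dim, ← Finset.add_sum_erase _ _ (Finset.mem_univ i)] at h ⊢
    simp only [Function.update_self]
    rw [Finset.sum_congr rfl fun i' hi' => by
      rw [Function.update_of_ne (Finset.ne_of_mem_erase hi')]]
    omega

lemma Box.exists_le_dim {r : ℕ} {n : Fin r → ℕ} {A : Box n} {m : ℕ} (h : m ≤ A.dim) :
    ∃ B ≤ A, B.dim = m := by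
  obtain ⟨l, hl⟩ := Nat.exists_eq_add_of_le h
  induction l generalizing A with
  | zero => exact ⟨A, le_rfl, hl⟩
  | succ l ih =>
    obtain ⟨B, hB, hd⟩ := Box.exists_lt_dim (m := m + l) (by omega : A.dim = m + l + 1)
    obtain ⟨C, hC, hd'⟩ := ih (A := B) (by omega) hd
    exact ⟨C, hC.trans hB.le, hd'⟩

section FacesOfProdSimplex

variable {r : ℕ} {n : Fin r → ℕ}

lemma isPolytope_prodSimplex : IsPolytope (prodSimplex n) := by
  classical
  refine ⟨(Set.Finite.pi (t := fun i => Set.range fun j j' : Fin (n i + 1) =>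
    if j = j' then (1 : ℝ) else 0) fun i => Set.finite_range _).toFinset, ?_⟩
  rw [Set.Finite.coe_toFinset, convexHull_pi, prodSimplex]
  simp_rw [convexHull_basis_eq_stdSimplex]

lemma mem_prodSimplex {x : (i : Fin r) → Fin (n i + 1) → ℝ} :
    x ∈ prodSimplex n ↔ ∀ i, (∀ j, 0 ≤ x i j) ∧ ∑ j, x i j = 1 := by
  simp [prodSimplex, stdSimplex]

/-- The face of the product of simplices encoded by a box. -/
def boxFace (A : Box n) : Set ((i : Fin r) → Fin (n i + 1) → ℝ) :=
  {x ∈ prodSimplex n | ∀ i j, j ∉ A.1 i → x i j = 0}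

/-- The vertices of the product of simplices. -/
def boxVertex (a : (i : Fin r) → Fin (n i + 1)) : (i : Fin r) → Fin (n i + 1) → ℝ :=
  fun i => Pi.single (a i) 1

lemma boxVertex_mem_boxFace {a : (i : Fin r) → Fin (n i + 1)} {A : Box n} :
    boxVertex a ∈ boxFace A ↔ Box.single a ≤ A := by
  rw [Box.single_le_iff]
  constructor
  · intro h i
    by_contra h'
    simpa [boxVertex] using h.2 i _ h'
  · intro h
    refine ⟨mem_prodSimplex.2 fun i => ⟨fun j => ?_, by simp [boxVertex]⟩, fun i j hj => ?_⟩
    · simp only [boxVertex, Pi.single_apply]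
      split_ifs <;> norm_num
    · refine Pi.single_eq_of_ne ?_ _
      rintro rfl
      exact hj (h i)

lemma boxFace_subset_iff {A B : Box n} : boxFace A ⊆ boxFace B ↔ A ≤ B := by
  constructor
  · intro h i j hj
    obtain ⟨a, ha⟩ := A.exists_single_le
    have ha' : Box.single (Function.update a i j) ≤ A := by
      rw [Box.single_le_iff] at ha ⊢
      intro i'
      rcases eq_or_ne i' i with rfl | h'
      · simpa using hj
      · simpa [h'] using ha i'
    simpa using Box.single_le_iff.1 (boxVertex_mem_boxFace.1 (h (boxVertex_mem_boxFace.2 ha'))) i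
  · exact fun h x hx => ⟨hx.1, fun i j hj => hx.2 i j fun h' => hj (h i h')⟩

lemma isFace_boxFace (A : Box n) : IsFace (prodSimplex n) (boxFace A) := by
  classical
  obtain ⟨a, ha⟩ := A.exists_single_le
  have hv := boxVertex_mem_boxFace.2 ha
  refine ⟨⟨_, hv⟩, -∑ i, ∑ j ∈ (A.1 i)ᶜ,
    (LinearMap.proj j : (Fin (n i + 1) → ℝ) →ₗ[ℝ] ℝ).comp (LinearMap.proj i), ?_⟩
  have happ : ∀ x : (i : Fin r) → Fin (n i + 1) → ℝ,
      (-∑ i, ∑ j ∈ (A.1 i)ᶜ,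
        (LinearMap.proj j : (Fin (n i + 1) → ℝ) →ₗ[ℝ] ℝ).comp (LinearMap.proj i) :
        ((i : Fin r) → Fin (n i + 1) → ℝ) →ₗ[ℝ] ℝ) x = -∑ i, ∑ j ∈ (A.1 i)ᶜ, x i j := by
    intro x; simp [LinearMap.sum_apply]
  have hnonneg : ∀ x ∈ prodSimplex n, 0 ≤ ∑ i, ∑ j ∈ (A.1 i)ᶜ, x i j := fun x hx =>
    Finset.sum_nonneg fun i _ => Finset.sum_nonneg fun j _ => (mem_prodSimplex.1 hx i).1 j
  have hzero : ∀ x ∈ boxFace A, ∑ i, ∑ j ∈ (A.1 i)ᶜ, x i j = 0 := fun x hx =>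
    Finset.sum_eq_zero fun i _ => Finset.sum_eq_zero fun j hj => hx.2 i j (by simpa using hj)
  ext x
  simp only [happ]
  constructor
  · intro hx
    refine ⟨hx.1, fun y hy => ?_⟩
    rw [hzero x hx, neg_zero, neg_nonpos]
    exact hnonneg y hy
  · rintro ⟨hx, h⟩
    have h1 := h _ hv.1
    rw [hzero _ hv, neg_zero] at h1
    have h2 : ∑ i, ∑ j ∈ (A.1 i)ᶜ, x i j = 0 := le_antisymm (by linarith) (hnonneg x hx)
    refine ⟨hx, fun i j hj => ?_⟩
    rw [Finset.sum_eq_zero_iff_of_nonneg fun i _ => Finset.sum_nonneg fun j _ =>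
      (mem_prodSimplex.1 hx i).1 j] at h2
    have h3 := h2 i (Finset.mem_univ i)
    rw [Finset.sum_eq_zero_iff_of_nonneg fun j _ => (mem_prodSimplex.1 hx i).1 j] at h3
    exact h3 j (by simpa using hj)

lemma sum_smul_single (x : (i : Fin r) → Fin (n i + 1) → ℝ) :
    x = ∑ i, ∑ j, x i j • (Pi.single i (Pi.single j 1) : (i : Fin r) → Fin (n i + 1) → ℝ) := by
  conv_lhs => rw [← Finset.univ_sum_single x]
  refine Finset.sum_congr rfl fun i _ => ?_
  conv_lhs => rw [← Finset.univ_sum_single (x i)]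
  ext i' j'
  rcases eq_or_ne i' i with rfl | h
  · simp [Finset.sum_apply, Pi.single_apply]
  · simp [Finset.sum_apply, h]

lemma exists_boxFace_eq {F : Set ((i : Fin r) → Fin (n i + 1) → ℝ)}
    (hF : IsFace (prodSimplex n) F) : ∃ A, boxFace A = F := by
  classical
  obtain ⟨-, c, rfl⟩ := hF
  let e : (i : Fin r) → Fin (n i + 1) → (i : Fin r) → Fin (n i + 1) → ℝ := fun i j =>
    Pi.single i (Pi.single j 1)
  have hmax : ∀ i, ∃ j, ∀ j', c (e i j') ≤ c (e i j) := fun i => by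
    obtain ⟨j, -, hj⟩ := Finset.exists_max_image Finset.univ (fun j => c (e i j))
      Finset.univ_nonempty
    exact ⟨j, fun j' => hj j' (Finset.mem_univ j')⟩
  choose a ha using hmax
  have hc : ∀ x, c x = ∑ i, ∑ j, x i j * c (e i j) := fun x => by
    conv_lhs => rw [sum_smul_single x]
    simp [map_sum, e]
  refine ⟨⟨fun i => {j | ∀ j', c (e i j') ≤ c (e i j)}, fun i => ⟨a i, by simpa using ha i⟩⟩, ?_⟩
  ext x
  constructor
  · rintro ⟨hx, h⟩
    refine ⟨hx, fun y hy => ?_⟩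
    rw [hc, hc]
    refine Finset.sum_le_sum fun i _ => ?_
    have h1 : ∑ j, x i j * c (e i j) = c (e i (a i)) := by
      rw [← one_mul (c (e i (a i))), ← (mem_prodSimplex.1 hx i).2, Finset.sum_mul]
      refine Finset.sum_congr rfl fun j _ => ?_
      by_cases hj : ∀ j', c (e i j') ≤ c (e i j)
      · rw [le_antisymm (ha i j) (hj (a i))]
      · rw [h i j (by simpa using hj), zero_mul, zero_mul]
    rw [h1, ← one_mul (c (e i (a i))), ← (mem_prodSimplex.1 hy i).2, Finset.sum_mul]
    exact Finset.sum_le_sum fun j _ => mul_le_mul_of_nonneg_left (ha i j)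
      ((mem_prodSimplex.1 hy i).1 j)
  · rintro ⟨hx, h⟩
    refine ⟨hx, fun i j hj => ?_⟩
    by_contra hne
    have hpos : 0 < x i j := lt_of_le_of_ne ((mem_prodSimplex.1 hx i).1 j) (Ne.symm hne)
    simp only [Finset.mem_filter, Finset.mem_univ, true_and, not_forall, not_le] at hj
    obtain ⟨j', hj'⟩ := hj
    have hjj : j' ≠ j := by rintro rfl; exact lt_irrefl _ hj'
    have hy : x + x i j • (e i j' - e i j) ∈ prodSimplex n := by
      rw [mem_prodSimplex]
      intro i'
      rcases eq_or_ne i' i with rfl | h'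
      · constructor
        · intro l
          have := (mem_prodSimplex.1 hx i').1 l
          simp only [e, Pi.add_apply, Pi.smul_apply, Pi.sub_apply, Pi.single_eq_same, smul_eq_mul,
            Pi.single_apply]
          split_ifs with h1 h2 h2
          · linarith
          · linarith
          · subst h2; linarith
          · linarith
        · simp [e, Finset.sum_add_distrib, ← Finset.mul_sum, (mem_prodSimplex.1 hx i').2]
      · simpa [e, h'] using mem_prodSimplex.1 hx i'
    have h1 := h _ hy
    rw [map_add, map_smul, map_sub, smul_eq_mul] at h1
    have := mul_pos hpos (sub_pos.2 hj')
    linarith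

/-- The faces of a product of simplices are encoded by boxes. -/
noncomputable def boxIso : Box n ≃o facesOf (prodSimplex n) :=
  RelIso.ofSurjective (OrderEmbedding.ofMapLEIff
    (fun A : Box n => (⟨boxFace A, isFace_boxFace A⟩ : facesOf (prodSimplex n)))
    fun _ _ => boxFace_subset_iff) fun F =>
      (exists_boxFace_eq F.2).imp fun _ h => Subtype.ext h

variable {E' : Type*} [AddCommGroup E'] [Module ℝ E']
  (f : ((i : Fin r) → Fin (n i + 1) → ℝ) →ₗ[ℝ] E')

lemma polyDim_mono [FiniteDimensional ℝ E'] {P G : Set E'} (h : P ⊆ G) : polyDim P ≤ polyDim G :=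
  Submodule.finrank_mono (AffineSubspace.direction_le (affineSpan_mono ℝ h))

lemma polyDim_image_boxFace_le (A : Box n) : polyDim (f '' boxFace A) ≤ A.dim := by
  classical
  obtain ⟨a, ha⟩ := A.exists_single_le
  rw [Box.single_le_iff] at ha
  let v : ((i : Fin r) × {j // j ∈ (A.1 i).erase (a i)}) → E' := fun p =>
    f (Pi.single p.1 (Pi.single p.2.1 1)) - f (Pi.single p.1 (Pi.single (a p.1) 1))
  have hcard : Fintype.card ((i : Fin r) × {j // j ∈ (A.1 i).erase (a i)}) = A.dim := by
    rw [Fintype.card_sigma, Box.dim]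
    refine Finset.sum_congr rfl fun i _ => ?_
    rw [Fintype.card_coe, Finset.card_erase_of_mem (ha i)]
  rw [← hcard]
  have : FiniteDimensional ℝ (Submodule.span ℝ (Set.range v)) :=
    FiniteDimensional.span_of_finite ℝ (Set.finite_range v)
  refine le_trans (Submodule.finrank_mono ?_) (finrank_range_le_card v)
  rw [direction_affineSpan, vectorSpan_def, Submodule.span_le]
  have hx : ∀ x ∈ boxFace A, f x - ∑ i, f (Pi.single i (Pi.single (a i) 1)) ∈
      Submodule.span ℝ (Set.range v) := by
    intro x hx
    have h1 : f x - ∑ i, f (Pi.single i (Pi.single (a i) 1)) = ∑ i, ∑ j, x i j •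
        (f (Pi.single i (Pi.single j 1)) - f (Pi.single i (Pi.single (a i) 1))) := by
      conv_lhs => rw [sum_smul_single x]
      simp only [map_sum, map_smul, smul_sub, Finset.sum_sub_distrib, ← Finset.sum_smul]
      congr 1
      refine Finset.sum_congr rfl fun i _ => ?_
      rw [(mem_prodSimplex.1 hx.1 i).2, one_smul]
    rw [h1]
    refine Submodule.sum_mem _ fun i _ => Submodule.sum_mem _ fun j _ => ?_
    by_cases hj : j ∈ A.1 i
    · rcases eq_or_ne j (a i) with rfl | hja
      · simp
      · exact Submodule.smul_mem _ _ (Submodule.subset_span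
          ⟨⟨i, j, Finset.mem_erase.2 ⟨hja, hj⟩⟩, rfl⟩)
    · simp [hx.2 i j hj]
  rintro _ ⟨_, ⟨x, hx1, rfl⟩, _, ⟨y, hy1, rfl⟩, rfl⟩
  simpa using Submodule.sub_mem _ (hx x hx1) (hx y hy1)

/-- The linear map `f` preserves the faces of the product of simplices of dimension at most `k`. -/
def PreservesFaces (k : ℕ) : Prop :=
  ∀ A : Box n, A.dim ≤ k → IsFace (f '' prodSimplex n) (f '' boxFace A) ∧
    ∀ x ∈ prodSimplex n, f x ∈ f '' boxFace A → x ∈ boxFace A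

variable {f} {k : ℕ}

lemma image_boxFace_subset_iff (hf : PreservesFaces f k) {A B : Box n} (hB : B.dim ≤ k) :
    f '' boxFace A ⊆ f '' boxFace B ↔ A ≤ B := by
  refine ⟨fun h => boxFace_subset_iff.1 fun x hx => ?_, fun h =>
    Set.image_mono (boxFace_subset_iff.2 h)⟩
  exact (hf B hB).2 x hx.1 (h (Set.mem_image_of_mem f hx))

lemma dim_le_polyDim_image [FiniteDimensional ℝ E'] (hf : PreservesFaces f k) {A : Box n}
    (hA : A.dim ≤ k + 1) : A.dim ≤ polyDim (f '' boxFace A) := by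
  generalize hm : A.dim = m
  induction m generalizing A with
  | zero => exact Nat.zero_le _
  | succ m ih =>
    obtain ⟨B, hBA, hB⟩ := Box.exists_lt_dim hm
    have hBk : B.dim ≤ k := by omega
    refine lt_of_le_of_lt (ih (by omega) hB) (polyDim_lt_of_ssubset (hf B hBk).1
      (Set.image_mono (isFace_boxFace A).subset)
      ⟨Set.image_mono (boxFace_subset_iff.2 hBA.le), fun h => ?_⟩)
    exact hBA.not_ge ((image_boxFace_subset_iff hf hBk).1 h)

/-- If the faces of the product of simplices of dimension at most `k` are preserved by a projection,
then they form the `k`-skeleton of the image. -/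
noncomputable def skelIso [FiniteDimensional ℝ E'] (hf : PreservesFaces f k) :
    {A : Box n // A.dim ≤ k} ≃o skel k (f '' prodSimplex n) :=
  RelIso.ofSurjective (OrderEmbedding.ofMapLEIff
    (fun A : {A : Box n // A.dim ≤ k} => (⟨f '' boxFace A.1, (hf A.1 A.2).1,
      (polyDim_image_boxFace_le f A.1).trans A.2⟩ : skel k (f '' prodSimplex n)))
    fun _ B => image_boxFace_subset_iff hf B.2) fun G => by
      obtain ⟨G, hG, hdim⟩ := G
      obtain ⟨A, hA⟩ := exists_boxFace_eq hG.inter_preimage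
      have hGA : f '' boxFace A = G := by
        rw [hA, image_inter_preimage_of_subset hG.subset]
      refine ⟨⟨A, ?_⟩, Subtype.ext hGA⟩
      by_contra! hlt
      obtain ⟨B, hBA, hB⟩ := Box.exists_le_dim (m := k + 1) hlt
      have h1 := dim_le_polyDim_image hf hB.le
      have h2 := polyDim_mono (Set.image_mono (f := f) (boxFace_subset_iff.2 hBA))
      rw [hGA] at h2
      omega

end FacesOfProdSimplex

/-- The `k`-skeleton of a product of simplices. -/
noncomputable def skelProdSimplexIso {r : ℕ} {n : Fin r → ℕ} (k : ℕ) :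
    {A : Box n // A.dim ≤ k} ≃o skel k (prodSimplex n) :=
  (skelIso (f := LinearMap.id) fun A _ => by
    simpa using isFace_boxFace A).trans (OrderIso.setCongr _ _ (by simp))

namespace Box

variable {r : ℕ} {n : Fin r → ℕ}

lemma le_iff_single {A B : Box n} : A ≤ B ↔ ∀ a, single a ≤ A → single a ≤ B := by
  refine ⟨fun h a ha => ha.trans h, fun h i j hj => ?_⟩
  obtain ⟨a, ha⟩ := A.exists_single_le
  rw [single_le_iff] at ha
  have h1 := h (Function.update a i j) (single_le_iff.2 fun i' => by
    rcases eq_or_ne i' i with rfl | h'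
    · simpa using hj
    · simpa [h'] using ha i')
  simpa using single_le_iff.1 h1 i

lemma single_le_single {a b : (i : Fin r) → Fin (n i + 1)} : single a ≤ single b ↔ a = b := by
  rw [single_le_iff, funext_iff]
  simp [single]

lemma dim_single (a : (i : Fin r) → Fin (n i + 1)) : (single a).dim = 0 := by simp [dim, single]

/-- Two vertices that differ in exactly one coordinate. -/
def Adj (a b : (i : Fin r) → Fin (n i + 1)) : Prop := ∃ i j, j ≠ a i ∧ b = Function.update a i j

lemma single_update_le {a b : (i : Fin r) → Fin (n i + 1)} {A : Box n} (ha : single a ≤ A)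
    (hb : single b ≤ A) (i : Fin r) : single (Function.update a i (b i)) ≤ A := by
  rw [single_le_iff] at *
  intro i'
  rcases eq_or_ne i' i with rfl | h'
  · simpa using hb i'
  · simpa [h'] using ha i'

/-- The box of the edge joining `a` to the vertex with `i`-th coordinate `j`. -/
def edge (a : (i : Fin r) → Fin (n i + 1)) (i : Fin r) (j : Fin (n i + 1)) : Box n :=
  ⟨Function.update (fun i => {a i}) i {a i, j}, fun i' => by
    rcases eq_or_ne i' i with rfl | h
    · simp
    · simp [h]⟩

lemma dim_edge_le (a : (i : Fin r) → Fin (n i + 1)) (i : Fin r) (j : Fin (n i + 1)) :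
    (edge a i j).dim ≤ 1 := by
  rw [dim, ← Finset.add_sum_erase _ _ (Finset.mem_univ i), Finset.sum_eq_zero]
  · have := Finset.card_le_two (a := a i) (b := j)
    simp only [edge, Function.update_self]
    omega
  · intro i' hi'
    simp [edge, Finset.ne_of_mem_erase hi']

lemma single_le_edge_iff {a b : (i : Fin r) → Fin (n i + 1)} {i : Fin r} {j : Fin (n i + 1)} :
    single b ≤ edge a i j ↔ b = a ∨ b = Function.update a i j := by
  rw [single_le_iff]
  constructor
  · intro h
    have hne : ∀ i' ≠ i, b i' = a i' := fun i' h' => by simpa [edge, h'] using h i'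
    have hi : b i = a i ∨ b i = j := by simpa [edge] using h i
    refine hi.imp (fun h0 => funext fun i' => ?_) (fun h0 => funext fun i' => ?_)
    · rcases eq_or_ne i' i with rfl | h'
      · exact h0
      · exact hne i' h'
    · rcases eq_or_ne i' i with rfl | h'
      · simpa using h0
      · simpa [h'] using hne i' h'
  · rintro (rfl | rfl) i'
    · rcases eq_or_ne i' i with rfl | h' <;> simp [edge, *]
    · rcases eq_or_ne i' i with rfl | h' <;> simp [edge, *]

open Classical in
lemma card_adj {a : (i : Fin r) → Fin (n i + 1)} {A : Box n} (ha : single a ≤ A) :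
    Finset.card {b | single b ≤ A ∧ Adj a b} = A.dim := by
  have haA := single_le_iff.1 ha
  have hdim : A.dim = (Finset.univ.sigma fun i => (A.1 i).erase (a i)).card := by
    rw [Finset.card_sigma, dim]
    exact Finset.sum_congr rfl fun i _ => (Finset.card_erase_of_mem (haA i)).symm
  rw [hdim]
  symm
  refine Finset.card_bij (fun p _ => Function.update a p.1 p.2) ?_ ?_ ?_
  · rintro ⟨i, j⟩ h
    simp only [Finset.mem_sigma, Finset.mem_univ, true_and, Finset.mem_erase] at h
    simp only [Finset.mem_filter, Finset.mem_univ, true_and]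
    refine ⟨single_le_iff.2 fun i' => ?_, i, j, h.1, rfl⟩
    rcases eq_or_ne i' i with rfl | h'
    · simpa using h.2
    · simpa [h'] using haA i'
  · rintro ⟨i, j⟩ h ⟨i', j'⟩ h' heq
    simp only [Finset.mem_sigma, Finset.mem_univ, true_and, Finset.mem_erase] at h h' heq
    have h1 := congrFun heq i
    rcases eq_or_ne i i' with rfl | hne
    · simp only [Function.update_self] at h1
      rw [h1]
    · rw [Function.update_self, Function.update_of_ne hne] at h1
      exact absurd h1 h.1
  · intro b hb
    simp only [Finset.mem_filter, Finset.mem_univ, true_and] at hb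
    obtain ⟨hb, i, j, hj, rfl⟩ := hb
    exact ⟨⟨i, j⟩, by simpa [hj] using single_le_iff.1 hb i, rfl⟩

/-- An order embedding of the poset of boxes of dimension at most `k` that sends vertices to
disjoint boxes is onto the boxes of dimension at most `k`. -/
theorem exists_eq_of_embedding {k : ℕ} (ψ : {A : Box n // A.dim ≤ k} → Box n)
    (hψ : ∀ A B, ψ A ≤ ψ B ↔ A ≤ B)
    (hdisj : ∀ a b C (ha : (single a).dim ≤ k) (hb : (single b).dim ≤ k),
      C ≤ ψ ⟨single a, ha⟩ → C ≤ ψ ⟨single b, hb⟩ → a = b)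
    (B : Box n) (hB : B.dim ≤ k) : ∃ A, ψ A = B := by
  classical
  have h0 : ∀ a : (i : Fin r) → Fin (n i + 1), (single a).dim ≤ k := fun a => by
    rw [dim_single]; exact Nat.zero_le k
  choose σ hσ using fun a => (ψ ⟨single a, h0 a⟩).exists_single_le
  have hinj : Function.Injective σ := fun a b hab =>
    hdisj a b (single (σ a)) (h0 a) (h0 b) (hσ a) (hab ▸ hσ b)
  have hbij : Function.Bijective σ := Finite.injective_iff_bijective.1 hinj
  have hvert : ∀ a, ψ ⟨single a, h0 a⟩ = single (σ a) := fun a => by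
    refine le_antisymm (le_iff_single.2 fun b hb => ?_) (hσ a)
    obtain ⟨b', rfl⟩ := hbij.2 b
    rw [hdisj a b' _ (h0 a) (h0 b') hb (hσ b')]
  have hmem : ∀ a A, single (σ a) ≤ ψ A ↔ single a ≤ A.1 := fun a A => by
    rw [← hvert, hψ]; rfl
  have hψinj : Function.Injective ψ := fun A B h =>
    le_antisymm ((hψ A B).1 h.le) ((hψ B A).1 h.ge)
  rcases Nat.eq_zero_or_pos k with rfl | hk
  · obtain ⟨b, hb⟩ := B.exists_single_le
    obtain ⟨a, rfl⟩ := hbij.2 b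
    refine ⟨⟨single a, h0 a⟩, ?_⟩
    rw [hvert]
    refine (le_single fun i j hj => ?_).symm
    have h1 : (B.1 i).card - 1 = 0 :=
      Finset.sum_eq_zero_iff.1 (Nat.le_zero.1 hB) i (Finset.mem_univ i)
    have h2 : (B.1 i).card ≤ 1 := by omega
    exact Finset.mem_singleton.2 (Finset.card_le_one.1 h2 j hj _ (single_le_iff.1 hb i))
  have hadj : ∀ a b, Adj a b → Adj (σ a) (σ b) := by
    rintro a _ ⟨i, j, hj, rfl⟩
    set b := Function.update a i j with hb
    have hab : σ a ≠ σ b := fun h => by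
      have := congrFun (hinj h) i
      simp [hb, hj.symm] at this
    obtain ⟨i', hi'⟩ := Function.ne_iff.1 hab
    let F : {A : Box n // A.dim ≤ k} := ⟨edge a i j, (dim_edge_le a i j).trans hk⟩
    have h1 := (hmem a F).2 (single_le_edge_iff.2 (Or.inl rfl))
    have h2 := (hmem b F).2 (single_le_edge_iff.2 (Or.inr rfl))
    have h3 := single_update_le h1 h2 i'
    obtain ⟨c, hc⟩ := hbij.2 (Function.update (σ a) i' (σ b i'))
    rw [← hc, hmem, single_le_edge_iff] at h3
    refine ⟨i', σ b i', hi'.symm, ?_⟩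
    rcases h3 with rfl | rfl
    · have := congrFun hc i'
      rw [Function.update_self] at this
      exact absurd this hi'
    · exact hc
  let s : Equiv.Perm ((i : Fin r) → Fin (n i + 1)) := Equiv.ofBijective σ hbij
  have hpow : ∀ (m : ℕ) a b, Adj a b → Adj ((s ^ m) a) ((s ^ m) b) := by
    intro m
    induction m with
    | zero => exact fun a b h => h
    | succ m ih =>
      intro a b h
      rw [pow_succ']
      exact hadj _ _ (ih a b h)
  have hadj' : ∀ a b, Adj (σ a) (σ b) → Adj a b := fun a b h => by
    have h1 : s ^ (orderOf s - 1) * s = 1 := by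
      rw [← pow_succ, Nat.sub_add_cancel (orderOf_pos s), pow_orderOf_eq_one]
    have h2 := hpow (orderOf s - 1) _ _ h
    have h3 : ∀ c, (s ^ (orderOf s - 1)) (σ c) = c := fun c => congrFun (congrArg DFunLike.coe h1) c
    rwa [h3, h3] at h2
  have hdim : ∀ A, (ψ A).dim = A.1.dim := by
    intro A
    obtain ⟨a, ha⟩ := A.1.exists_single_le
    rw [← card_adj ha, ← card_adj ((hmem a A).2 ha)]
    symm
    refine Finset.card_bij (fun b _ => σ b) ?_ (fun b _ b' _ h => hinj h) ?_
    · intro b hb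
      simp only [Finset.mem_filter, Finset.mem_univ, true_and] at hb ⊢
      exact ⟨(hmem b A).2 hb.1, hadj _ _ hb.2⟩
    · intro b hb
      obtain ⟨c, rfl⟩ := hbij.2 b
      simp only [Finset.mem_filter, Finset.mem_univ, true_and] at hb
      exact ⟨c, by simpa using ⟨(hmem c A).1 hb.1, hadj' _ _ hb.2⟩, rfl⟩
  let θ : {A : Box n // A.dim ≤ k} → {A : Box n // A.dim ≤ k} := fun A =>
    ⟨ψ A, (hdim A).trans_le A.2⟩
  have hθ : Function.Injective θ := fun A B h => hψinj (congrArg Subtype.val h)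
  have hsurj : Function.Surjective θ := Finite.injective_iff_surjective.1 hθ
  obtain ⟨A, hA⟩ := hsurj ⟨B, hB⟩
  exact ⟨A, congrArg Subtype.val hA⟩

end Box

theorem IsPPSN.le_polyDim {E : Type*} [AddCommGroup E] [Module ℝ E] [FiniteDimensional ℝ E]
    {k r : ℕ} (hr : 1 ≤ r) {n : Fin r → ℕ} (hn : ∀ i, 2 ≤ n i) (hk : k ≤ ∑ i, (n i - 2) / 2)
    {P : Set E} (hP : IsPPSN k n P) : 2 * k + r + 1 ≤ polyDim P := by
  obtain ⟨⟨-, ⟨e⟩⟩, N, Q, f, hQ, rfl, ⟨e'⟩⟩ := hP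
  let Ψ : Box n ≃o facesOf Q := boxIso.trans e'.symm
  let φ : {A : Box n // A.dim ≤ k} ≃o skel k (f '' Q) := (skelProdSimplexIso k).trans e.symm
  have hφ : ∀ A, IsFace (f '' Q) (φ A : Set E) := fun A => (φ A).2.1
  choose ψ hψ using fun A => exists_box_eq Ψ (hφ A).inter_preimage
  have himage : ∀ A, f '' (Ψ (ψ A) : Set _) = φ A := fun A => by
    rw [hψ, image_inter_preimage_of_subset (hφ A).subset]
  have hle : ∀ A B, ψ A ≤ ψ B ↔ A ≤ B := by
    intro A B
    rw [← box_subset_iff Ψ, ← φ.le_iff_le]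
    constructor
    · intro h
      change (φ A : Set E) ⊆ φ B
      rw [← himage, ← himage]
      exact Set.image_mono h
    · intro h
      rw [hψ, hψ]
      exact Set.inter_subset_inter_right _ (Set.preimage_mono h)
  have hdisj : ∀ a b C (ha : (Box.single a).dim ≤ k) (hb : (Box.single b).dim ≤ k),
      C ≤ ψ ⟨Box.single a, ha⟩ → C ≤ ψ ⟨Box.single b, hb⟩ → a = b := by
    intro a b C ha hb hCa hCb
    obtain ⟨x, hx⟩ := (isFace_box Ψ C).1
    have hxa : f x ∈ (φ ⟨Box.single a, ha⟩ : Set E) := by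
      rw [← himage]; exact ⟨x, (box_subset_iff Ψ).2 hCa hx, rfl⟩
    have hxb : f x ∈ (φ ⟨Box.single b, hb⟩ : Set E) := by
      rw [← himage]; exact ⟨x, (box_subset_iff Ψ).2 hCb hx, rfl⟩
    let G : skel k (f '' Q) := ⟨_, (hφ _).inter (hφ _) ⟨_, hxa, hxb⟩,
      (polyDim_mono Set.inter_subset_left).trans (φ ⟨Box.single a, ha⟩).2.2⟩
    have h1 : φ.symm G ≤ ⟨Box.single a, ha⟩ := φ.symm_apply_le.2 Set.inter_subset_left
    have h2 : φ.symm G ≤ ⟨Box.single b, hb⟩ := φ.symm_apply_le.2 Set.inter_subset_right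
    obtain ⟨c, hc⟩ := (φ.symm G).1.exists_single_le
    rw [← Box.single_le_single.1 (hc.trans h1), ← Box.single_le_single.1 (hc.trans h2)]
  refine le_polyDim_image Ψ f hr hQ hn hk fun B hB => ?_
  obtain ⟨A, rfl⟩ := Box.exists_eq_of_embedding ψ hle hdisj B hB
  obtain ⟨-, c, hc⟩ := hφ A
  refine ⟨c, ?_⟩
  rw [hψ, hc]
  ext x
  simp only [Set.mem_inter_iff, Set.mem_preimage, Set.mem_ofPred_eq, Set.forall_mem_image]
  exact ⟨fun h => ⟨h.1, h.2.2⟩, fun h => ⟨h.1, ⟨x, h.1, rfl⟩, h.2⟩⟩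

section Farkas

/-- A theorem of alternatives: a subspace contains a vector with prescribed zero set that is
positive elsewhere unless there is a certificate against it in its orthogonal complement. -/
lemma exists_mem_zero_pos {J : Type*} [Fintype J] [DecidableEq J] (U : Submodule ℝ (J → ℝ))
    (A : Set J) (hU : ∀ X : J → ℝ, (∀ h ∈ U, ∑ j, X j * h j = 0) → (∀ j ∉ A, 0 ≤ X j) →
      ∀ j ∉ A, X j = 0) :
    ∃ h ∈ U, (∀ j ∈ A, h j = 0) ∧ ∀ j ∉ A, 0 < h j := by
  classical
  let Z : Submodule ℝ (J → ℝ) := ⨅ j ∈ A, LinearMap.ker (LinearMap.proj j)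
  have hZ : ∀ h, h ∈ Z ↔ ∀ j ∈ A, h j = 0 := fun h => by simp [Z, Submodule.mem_iInf]
  let s : Set (J → ℝ) := ⋂ j ∈ Aᶜ, {h | 0 < h j}
  have hs : ∀ h, h ∈ s ↔ ∀ j ∉ A, 0 < h j := fun h => by simp [s]
  by_contra! hno
  have hdisj : Disjoint s (U ⊓ Z : Submodule ℝ (J → ℝ)) := by
    rw [Set.disjoint_left]
    intro h h1 h2
    obtain ⟨j, hj, hle⟩ := hno h h2.1 ((hZ h).1 h2.2)
    exact absurd ((hs h).1 h1 j hj) (not_lt.2 hle)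
  have hsconv : Convex ℝ s := convex_iInter₂ fun j _ =>
    convex_halfSpace_gt (LinearMap.proj j : (J → ℝ) →ₗ[ℝ] ℝ).isLinear 0
  have hsopen : IsOpen s := (Set.toFinite Aᶜ).isOpen_biInter fun j _ =>
    isOpen_lt continuous_const (continuous_apply j)
  obtain ⟨f, u, hfs, hfU⟩ := geometric_hahn_banach_open hsconv hsopen
    (U ⊓ Z : Submodule ℝ (J → ℝ)).convex hdisj
  have hu : u ≤ 0 := by simpa using hfU 0 (Submodule.zero_mem _)
  have hfzero : ∀ v ∈ (U ⊓ Z : Submodule ℝ (J → ℝ)), f v = 0 := by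
    intro v hv
    by_contra hne
    have h1 := hfU (((u - 1) / f v) • v) (Submodule.smul_mem _ _ hv)
    rw [map_smul, smul_eq_mul, div_mul_cancel₀ _ hne] at h1
    linarith
  have hdual : (-f : (J → ℝ) →L[ℝ] ℝ).toLinearMap ∈
      U.dualAnnihilator ⊔ Z.dualAnnihilator := by
    rw [← Subspace.dualAnnihilator_inf_eq, Submodule.mem_dualAnnihilator]
    intro v hv
    simp [hfzero v hv]
  obtain ⟨F, hF, G, hG, hFG⟩ := Submodule.mem_sup.1 hdual
  rw [Submodule.mem_dualAnnihilator] at hF hG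
  let e : J → ℝ := fun j => if j ∈ A then 0 else 1
  have he : e ∈ s := (hs e).2 fun j hj => by simp [e, hj]
  have hX : ∀ j ∉ A, F (Pi.single j 1) = -f (Pi.single j 1) := by
    intro j hj
    have h1 := LinearMap.congr_fun hFG (Pi.single j 1)
    have h2 := hG (Pi.single j 1) ((hZ _).2 fun j' hj' =>
      Pi.single_eq_of_ne (by rintro rfl; exact hj hj') _)
    rw [LinearMap.add_apply, h2, add_zero] at h1
    simpa using h1
  have hF0 := hU (fun j => F (Pi.single j 1)) (fun h hh => by
    rw [← hF h hh]
    conv_rhs => rw [← Finset.univ_sum_single h, map_sum]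
    refine Finset.sum_congr rfl fun j _ => ?_
    rw [mul_comm, ← smul_eq_mul, ← map_smul, ← Pi.single_smul, smul_eq_mul, mul_one])
    (fun j hj => by
      rw [hX j hj, neg_nonneg]
      by_contra! hpos
      have h1 := hfs
        (e + ((u - f e) / f (Pi.single j 1)) • Pi.single j 1) ((hs _).2 fun j' hj' => by
        have h2 : 0 < (u - f e) / f (Pi.single j 1) := div_pos (sub_pos.2 (hfs e he)) hpos
        have h3 := (hs e).1 he j' hj'
        simp only [Pi.add_apply, Pi.smul_apply, smul_eq_mul, Pi.single_apply]
        split_ifs <;> linarith)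
      rw [map_add, map_smul, smul_eq_mul, div_mul_cancel₀ _ hpos.ne'] at h1
      linarith)
  have hfe : f e = 0 := by
    rw [← Finset.univ_sum_single e, map_sum]
    refine Finset.sum_eq_zero fun j _ => ?_
    by_cases hj : j ∈ A
    · simp [e, hj]
    · have h1 := hX j hj
      rw [hF0 j hj] at h1
      simp only [e, hj, if_false]
      linarith
  have := hfs e he
  linarith

end Farkas

section SignChanges

open Polynomial

variable {A : Finset ℕ} {Z : ℕ → ℝ}

lemma sub_le_sub_of_convex (hA : ∀ u, u + 1 ∉ A → 0 ≤ Z (u + 2) - 2 * Z (u + 1) + Z u) {p q : ℕ}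
    (hpq : ∀ u, p < u → u ≤ q → u ∉ A) {u : ℕ} (hpu : p ≤ u) (huq : u ≤ q) :
    Z (p + 1) - Z p ≤ Z (u + 1) - Z u := by
  induction u, hpu using Nat.le_induction with
  | base => exact le_rfl
  | succ u hpu ih =>
    have h1 := ih (by omega)
    have h2 := hA u (hpq _ (by omega) huq)
    have h3 : Z (u + 1 + 1) = Z (u + 2) := rfl
    linarith

/-- A function with few places of concavity has the sign pattern of a polynomial of low degree. -/
lemma exists_polynomial_sign (hA : ∀ u, u + 1 ∉ A → 0 ≤ Z (u + 2) - 2 * Z (u + 1) + Z u) {M : ℕ}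
    (hZ : ∀ u, M ≤ u → Z u = 0) (c : ℕ) : ∀ p : ℕ, (A.filter (p < ·)).card ≤ c →
    Z p ≤ Z (p + 1) → 0 ≤ Z (p + 1) →
    ∃ g : ℝ[X], g.natDegree ≤ 2 * ((A.filter (p < ·)).card - 1) ∧
      (∀ u : ℕ, u ≤ p → 0 < g.eval (u : ℝ)) ∧
      ∀ u : ℕ, p < u → (Z u < 0 → g.eval (u : ℝ) < 0) ∧ (0 ≤ Z u → 0 < g.eval (u : ℝ)) := by
  classical
  induction c with
  | zero =>
    intro p hp h1 h2
    refine ⟨1, by simp, by simp, fun u hu => ⟨fun hneg => ?_, by simp⟩⟩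
    have hno : ∀ v, p < v → v ∉ A := fun v hv hvA => by
      rw [Nat.le_zero, Finset.card_eq_zero, Finset.filter_eq_empty_iff] at hp
      exact hp hvA hv
    have hmono : ∀ v, p ≤ v → 0 ≤ Z (v + 1) := by
      intro v hv
      induction v, hv using Nat.le_induction with
      | base => exact h2
      | succ v hv ih =>
        have := sub_le_sub_of_convex hA (q := v + 1) (fun w hw _ => hno w hw) (u := v + 1)
          (by omega) le_rfl
        linarith
    obtain ⟨v, rfl⟩ : ∃ v, u = v + 1 := ⟨u - 1, by omega⟩
    exact absurd (hmono v (by omega)) (not_le.2 hneg)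
  | succ c ih =>
    intro p hp h1 h2
    by_cases hneg : ∃ u, p < u ∧ Z u < 0
    swap
    · push Not at hneg
      exact ⟨1, by simp, by simp, fun u hu => ⟨fun h => absurd (hneg u hu) (not_le.2 h), by simp⟩⟩
    set l := Nat.find hneg with hl
    obtain ⟨hpl, hZl⟩ := Nat.find_spec hneg
    rw [← hl] at hpl hZl
    have hlmin : ∀ u, p < u → u < l → 0 ≤ Z u := fun u hu hul => by
      have := Nat.find_min hneg hul
      push Not at this
      exact this hu
    have hex : ∃ v, l ≤ v ∧ 0 ≤ Z v := ⟨max M l, le_max_right _ _, (hZ _ (le_max_left _ _)).ge⟩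
    obtain ⟨hlv, hZv⟩ := Nat.find_spec hex
    have hvmin : ∀ u, l ≤ u → u < Nat.find hex → Z u < 0 := fun u hu huv => by
      have := Nat.find_min hex huv
      push Not at this
      exact this hu
    obtain ⟨m, hm⟩ : ∃ m, Nat.find hex = m + 1 := ⟨Nat.find hex - 1, by omega⟩
    rw [hm] at hlv hZv hvmin
    have hlm : l ≤ m := by
      by_contra! h
      rw [show m + 1 = l by omega] at hZv
      linarith
    have hZm := hvmin m hlm (by omega)
    obtain ⟨a, haA, hpa, hal⟩ : ∃ a ∈ A, p < a ∧ a < l := by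
      by_contra! hno
      have hmono : ∀ v, p ≤ v → v < l → 0 ≤ Z (v + 1) := by
        intro v hv
        induction v, hv using Nat.le_induction with
        | base => exact fun _ => h2
        | succ v hv ih =>
          intro hvl
          have := sub_le_sub_of_convex hA (q := v + 1) (fun w hw hw' hwA => by
            have := hno w hwA hw
            omega) (u := v + 1) (by omega) le_rfl
          have := ih (by omega)
          linarith
      have := hmono (l - 1) (by omega) (by omega)
      rw [show l - 1 + 1 = l by omega] at this
      linarith
    obtain ⟨b, hbA, hmb⟩ : ∃ b ∈ A, m < b := by
      by_contra! hno
      have h3 := sub_le_sub_of_convex hA (p := m) (q := max M m) (fun w hw _ hwA => by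
        have := hno w hwA
        omega) (u := max M m) (le_max_right _ _) le_rfl
      rw [hZ _ (le_max_left _ _), hZ (max M m + 1) (by omega)] at h3
      linarith
    have hlt : (A.filter (m < ·)).card < (A.filter (p < ·)).card := by
      refine Finset.card_lt_card ⟨fun x hx => ?_, fun h => ?_⟩
      · rw [Finset.mem_filter] at hx ⊢
        exact ⟨hx.1, by omega⟩
      · have := h (Finset.mem_filter.2 ⟨haA, hpa⟩)
        rw [Finset.mem_filter] at this
        omega
    have hpos : 0 < (A.filter (m < ·)).card := Finset.card_pos.2 ⟨b, Finset.mem_filter.2 ⟨hbA, hmb⟩⟩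
    obtain ⟨g, hg, hgm, hgs⟩ := ih m (by omega) (hZm.le.trans hZv) hZv
    have heval : ∀ u : ℕ, ((X - C ((l : ℝ) - 1 / 2)) * (X - C ((m : ℝ) + 1 / 2)) * g).eval (u : ℝ) =
        ((u : ℝ) - (l - 1 / 2)) * (u - (m + 1 / 2)) * g.eval (u : ℝ) := fun u => by simp
    refine ⟨(X - C ((l : ℝ) - 1 / 2)) * (X - C ((m : ℝ) + 1 / 2)) * g, ?_, ?_, ?_⟩
    · refine natDegree_mul_le.trans ?_
      have h3 : ((X - C ((l : ℝ) - 1 / 2)) * (X - C ((m : ℝ) + 1 / 2))).natDegree ≤ 2 :=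
        natDegree_mul_le.trans (by rw [natDegree_X_sub_C, natDegree_X_sub_C])
      omega
    · intro u hu
      have h3 : (u : ℝ) + 1 ≤ l := by exact_mod_cast (by omega : u + 1 ≤ l)
      have h4 : (u : ℝ) ≤ m := by exact_mod_cast (by omega : u ≤ m)
      rw [heval]
      exact mul_pos (mul_pos_of_neg_of_neg (by linarith) (by linarith)) (hgm u (by omega))
    · intro u hu
      rw [heval]
      rcases lt_or_ge u l with hul | hul
      · have h3 : (u : ℝ) + 1 ≤ l := by exact_mod_cast hul
        have h4 : (u : ℝ) ≤ m := by exact_mod_cast (by omega : u ≤ m)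
        have h5 := hlmin u hu hul
        exact ⟨fun h => absurd h (not_lt.2 h5), fun _ =>
          mul_pos (mul_pos_of_neg_of_neg (by linarith) (by linarith)) (hgm u (by omega))⟩
      have h3 : (l : ℝ) ≤ u := by exact_mod_cast hul
      rcases le_or_gt u m with hum | hum
      · have h4 : (u : ℝ) ≤ m := by exact_mod_cast hum
        have h5 := hvmin u hul (by omega)
        exact ⟨fun _ => mul_neg_of_neg_of_pos
          (mul_neg_of_pos_of_neg (by linarith) (by linarith)) (hgm u hum),
          fun h => absurd h (not_le.2 h5)⟩
      · have h4 : (m : ℝ) + 1 ≤ u := by exact_mod_cast hum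
        have h5 : 0 < ((u : ℝ) - (l - 1 / 2)) * (u - (m + 1 / 2)) :=
          mul_pos (by linarith) (by linarith)
        exact ⟨fun h => mul_neg_of_pos_of_neg h5 ((hgs u hum).1 h),
          fun h => mul_pos h5 ((hgs u hum).2 h)⟩

end SignChanges

lemma second_difference_tsub (t u : ℕ) :
    ((t - (u + 2) : ℕ) : ℝ) - 2 * ((t - (u + 1) : ℕ) : ℝ) + ((t - u : ℕ) : ℝ) =
      if t = u + 1 then 1 else 0 := by
  rcases lt_trichotomy t (u + 1) with h | rfl | h
  · rw [if_neg h.ne, Nat.sub_eq_zero_of_le (by omega), Nat.sub_eq_zero_of_le (by omega),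
      Nat.sub_eq_zero_of_le (by omega)]
    simp
  · simp
  · rw [if_neg h.ne', Nat.cast_sub (by omega), Nat.cast_sub (by omega), Nat.cast_sub (by omega)]
    push_cast
    ring

section Projection

variable {r : ℕ} {n : Fin r → ℕ}

lemma exists_separated_blocks (n : Fin r → ℕ) : ∃ s : Fin r → ℕ, (∀ i, 1 ≤ s i) ∧
    ∀ i i', i ≠ i' → s i + n i ≤ s i' ∨ s i' + n i' ≤ s i := by
  refine ⟨fun i => 1 + i * ∑ i, n i, fun i => Nat.le_add_right _ _, ?_⟩
  have h : ∀ i i' : Fin r, i < i' → 1 + i * (∑ i, n i) + n i ≤ 1 + i' * ∑ i, n i := by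
    intro i i' hlt
    have h1 := Finset.single_le_sum (f := n) (fun _ _ => Nat.zero_le _) (Finset.mem_univ i)
    have h2 : ((i : ℕ) + 1) * (∑ i, n i) ≤ i' * ∑ i, n i := Nat.mul_le_mul_right _ hlt
    rw [add_mul, one_mul] at h2
    omega
  intro i i' hne
  rcases lt_or_gt_of_ne hne with hlt | hlt
  · exact Or.inl (h i i' hlt)
  · exact Or.inr (h i' i hlt)

lemma eq_zero_of_moments {s : Fin r → ℕ} (hs : ∀ i, 1 ≤ s i)
    (hsep : ∀ i i', i ≠ i' → s i + n i ≤ s i' ∨ s i' + n i' ≤ s i) {B : ℕ}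
    (hB : ∀ i, s i + n i ≤ B) {k : ℕ} {A : Box n} (hA : A.dim ≤ k)
    {X : (i : Fin r) → Fin (n i + 1) → ℝ} (h0 : ∀ i, ∑ j, X i j = 0)
    (h1 : ∀ i, ∑ j, X i j * ((s i + j : ℕ) : ℝ) = 0)
    (h2 : ∀ m ∈ Finset.range (2 * k + 1),
      ∑ i, ∑ j, X i j * ∑ u ∈ Finset.range B, ((s i + j - u : ℕ) : ℝ) * (u : ℝ) ^ m = 0)
    (hpos : ∀ i j, j ∉ A.1 i → 0 ≤ X i j) (i : Fin r) (j : Fin (n i + 1)) : X i j = 0 := by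
  classical
  let Z : Fin r → ℕ → ℝ := fun i u => ∑ j, X i j * ((s i + j - u : ℕ) : ℝ)
  have hdiff : ∀ i u, Z i (u + 2) - 2 * Z i (u + 1) + Z i u =
      ∑ j, X i j * if s i + j = u + 1 then 1 else 0 := by
    intro i u
    simp only [Z, Finset.mul_sum, ← Finset.sum_sub_distrib, ← Finset.sum_add_distrib]
    refine Finset.sum_congr rfl fun j _ => ?_
    rw [← second_difference_tsub]
    ring
  have hlow : ∀ i u, u ≤ s i → Z i u = 0 := by
    intro i u hu
    have h3 : ∀ j : Fin (n i + 1), X i j * ((s i + j - u : ℕ) : ℝ) =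
        X i j * ((s i + j : ℕ) : ℝ) - X i j * u := fun j => by
      rw [Nat.cast_sub (by omega)]
      ring
    simp only [Z, h3, Finset.sum_sub_distrib, ← Finset.sum_mul, h0, h1]
    ring
  have hhigh : ∀ i u, s i + n i ≤ u → Z i u = 0 := by
    intro i u hu
    refine Finset.sum_eq_zero fun j _ => ?_
    have := j.2
    rw [Nat.sub_eq_zero_of_le (by omega), Nat.cast_zero, mul_zero]
  have hpoly : ∀ i, ∃ g : Polynomial ℝ, g.natDegree ≤ 2 * ((A.1 i).card - 1) ∧
      ∀ u : ℕ, (Z i u < 0 → g.eval (u : ℝ) < 0) ∧ (0 ≤ Z i u → 0 < g.eval (u : ℝ)) := by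
    intro i
    have hsi := hs i
    have hZ1 := hlow i (s i - 1) (by omega)
    have hZ2 := hlow i (s i - 1 + 1) (by omega)
    obtain ⟨g, hg, hg1, hg2⟩ := exists_polynomial_sign (A := (A.1 i).image fun j => s i + j.1)
      (Z := Z i) (fun u hu => by
        rw [hdiff]
        refine Finset.sum_nonneg fun j _ => ?_
        split_ifs with h
        · rw [mul_one]
          refine hpos i j fun hj => hu ?_
          rw [← h]
          exact Finset.mem_image_of_mem _ hj
        · rw [mul_zero]) (hhigh i) _ (s i - 1) le_rfl (by rw [hZ1, hZ2]) hZ2.ge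
    refine ⟨g, hg.trans ?_, fun u => ?_⟩
    · have := (Finset.card_filter_le ((A.1 i).image fun j => s i + j.1) (s i - 1 < ·)).trans
        Finset.card_image_le
      omega
    · rcases le_or_gt u (s i - 1) with hu | hu
      · exact ⟨fun h => absurd (hlow i u (by omega)) h.ne, fun _ => hg1 u hu⟩
      · exact hg2 u hu
  choose g hgdeg hg using hpoly
  have hdeg : (∏ i, g i).natDegree < 2 * k + 1 := by
    have h3 := (Polynomial.natDegree_prod_le Finset.univ g).trans
      (Finset.sum_le_sum fun i _ => hgdeg i)
    rw [← Finset.mul_sum] at h3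
    have h4 : ∑ i, ((A.1 i).card - 1) ≤ k := hA
    omega
  have hprod : ∀ i u, Z i u ≠ 0 → 0 < Z i u * (∏ i, g i).eval (u : ℝ) := by
    intro i u hne
    have hrange : s i < u ∧ u < s i + n i :=
      ⟨not_le.1 fun h => hne (hlow i u h), not_le.1 fun h => hne (hhigh i u h)⟩
    have hother : 0 < ∏ i' ∈ Finset.univ.erase i, (g i').eval (u : ℝ) := by
      refine Finset.prod_pos fun i' hi' => (hg i' u).2 (Eq.ge ?_)
      rcases hsep i' i (Finset.ne_of_mem_erase hi') with h | h
      · exact hhigh i' u (by omega)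
      · exact hlow i' u (by omega)
    rw [Polynomial.eval_prod, ← Finset.mul_prod_erase _ _ (Finset.mem_univ i), ← mul_assoc]
    refine mul_pos ?_ hother
    rcases lt_or_gt_of_ne hne with h | h
    · exact mul_pos_of_neg_of_neg h ((hg i u).1 h)
    · exact mul_pos h ((hg i u).2 h.le)
  have hnonneg : ∀ i u, 0 ≤ Z i u * (∏ i, g i).eval (u : ℝ) := by
    intro i u
    by_cases h : Z i u = 0
    · rw [h, zero_mul]
    · exact (hprod i u h).le
  have hsum : ∑ i, ∑ u ∈ Finset.range B, Z i u * (∏ i, g i).eval (u : ℝ) = 0 := by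
    calc ∑ i, ∑ u ∈ Finset.range B, Z i u * (∏ i, g i).eval (u : ℝ)
        = ∑ i, ∑ u ∈ Finset.range B, ∑ m ∈ Finset.range (2 * k + 1),
            (∏ i, g i).coeff m * (Z i u * (u : ℝ) ^ m) := by
          refine Finset.sum_congr rfl fun i _ => Finset.sum_congr rfl fun u _ => ?_
          rw [Polynomial.eval_eq_sum_range' hdeg, Finset.mul_sum]
          exact Finset.sum_congr rfl fun m _ => by ring
      _ = ∑ m ∈ Finset.range (2 * k + 1), (∏ i, g i).coeff m *
            ∑ i, ∑ u ∈ Finset.range B, Z i u * (u : ℝ) ^ m := by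
          simp only [Finset.mul_sum]
          refine (Finset.sum_congr rfl fun i _ => Finset.sum_comm).trans ?_
          rw [Finset.sum_comm]
      _ = 0 := by
          refine Finset.sum_eq_zero fun m hm => ?_
          have h3 : ∀ i, ∑ u ∈ Finset.range B, Z i u * (u : ℝ) ^ m =
              ∑ j, X i j * ∑ u ∈ Finset.range B, ((s i + j - u : ℕ) : ℝ) * (u : ℝ) ^ m := by
            intro i
            simp only [Z, Finset.sum_mul, Finset.mul_sum, mul_assoc]
            exact Finset.sum_comm
          rw [Finset.sum_congr rfl fun i _ => h3 i, h2 m hm, mul_zero]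
  have hZ : ∀ i u, Z i u = 0 := by
    intro i u
    rcases lt_or_ge u B with hu | hu
    · by_contra hne
      rw [Finset.sum_eq_zero_iff_of_nonneg fun i _ => Finset.sum_nonneg fun u _ => hnonneg i u]
        at hsum
      have h3 := hsum i (Finset.mem_univ i)
      rw [Finset.sum_eq_zero_iff_of_nonneg fun u _ => hnonneg i u] at h3
      exact (hprod i u hne).ne' (h3 u (Finset.mem_range.2 hu))
    · exact hhigh i u ((hB i).trans hu)
  have hsi := hs i
  have h3 := hdiff i (s i + j - 1)
  rw [hZ, hZ, hZ, show s i + j - 1 + 1 = s i + j by omega] at h3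
  simpa [Fin.val_inj] using h3.symm

end Projection

section Existence

variable {r : ℕ} {n : Fin r → ℕ}

/-- There is a configuration of points of a vector space of dimension `2 * k + r + 1` such that, for
every box of dimension at most `k`, a linear functional separates the corresponding points from
the others, up to a shift on each block. -/
lemma exists_separated_configuration (n : Fin r → ℕ) (k : ℕ) :
    ∃ w : (i : Fin r) → Fin (n i + 1) → Fin (2 * k + r + 1) → ℝ, ∀ A : Box n, A.dim ≤ k →
      ∃ (c : (Fin (2 * k + r + 1) → ℝ) →ₗ[ℝ] ℝ) (γ : Fin r → ℝ), ∀ i j,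
        (j ∈ A.1 i → γ i + c (w i j) = 0) ∧ (j ∉ A.1 i → 0 < γ i + c (w i j)) := by
  classical
  obtain ⟨s, hs, hsep⟩ := exists_separated_blocks n
  let B : ℕ := ∑ i, (s i + n i)
  have hB : ∀ i, s i + n i ≤ B := fun i =>
    Finset.single_le_sum (f := fun i => s i + n i) (fun _ _ => Nat.zero_le _) (Finset.mem_univ i)
  let w : (i : Fin r) → Fin (n i + 1) → (Fin r → ℝ) × (Fin (2 * k + 1) → ℝ) := fun i j =>
    (Pi.single i ((s i + j : ℕ) : ℝ),
      fun m => ∑ u ∈ Finset.range B, ((s i + j - u : ℕ) : ℝ) * (u : ℝ) ^ (m : ℕ))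
  let e : ((Fin r → ℝ) × (Fin (2 * k + 1) → ℝ)) ≃ₗ[ℝ] (Fin (2 * k + r + 1) → ℝ) :=
    LinearEquiv.ofFinrankEq _ _ (by
      rw [Module.finrank_prod, Module.finrank_fin_fun, Module.finrank_fin_fun,
        Module.finrank_fin_fun]
      ring)
  refine ⟨fun i j => e (w i j), fun A hA => ?_⟩
  let L : ((Fin r → ℝ) × Module.Dual ℝ ((Fin r → ℝ) × (Fin (2 * k + 1) → ℝ))) →ₗ[ℝ]
      ((Σ i, Fin (n i + 1)) → ℝ) :=
    LinearMap.pi fun p =>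
      (LinearMap.proj (φ := fun _ : Fin r => ℝ) p.1).comp (LinearMap.fst ℝ _ _) +
        (Module.Dual.eval ℝ _ (w p.1 p.2)).comp (LinearMap.snd ℝ _ _)
  have hfarkas := exists_mem_zero_pos (LinearMap.range L) {p | p.2 ∈ A.1 p.1} (by
    intro X hX hpos p _
    have hX' : ∀ (γ : Fin r → ℝ) (c : Module.Dual ℝ ((Fin r → ℝ) × (Fin (2 * k + 1) → ℝ))),
        ∑ i, ∑ j, X ⟨i, j⟩ * (γ i + c (w i j)) = 0 := fun γ c => by
      rw [← hX _ ⟨(γ, c), rfl⟩, Fintype.sum_sigma]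
      rfl
    refine eq_zero_of_moments hs hsep hB hA (X := fun i j => X ⟨i, j⟩) ?_ ?_ ?_
      (fun i j hj => hpos ⟨i, j⟩ hj) p.1 p.2
    · intro i
      rw [← hX' (Pi.single i 1) 0, Finset.sum_eq_single_of_mem i (Finset.mem_univ i)]
      · simp
      · intro i' _ h
        simp [h]
    · intro i
      rw [← hX' 0 ((LinearMap.proj i).comp (LinearMap.fst ℝ _ _)),
        Finset.sum_eq_single_of_mem i (Finset.mem_univ i)]
      · simp [w]
      · intro i' _ h
        simp [w, h.symm]
    · intro m hm
      rw [← hX' 0 ((LinearMap.proj ⟨m, Finset.mem_range.1 hm⟩).comp (LinearMap.snd ℝ _ _))]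
      simp [w])
  obtain ⟨_, ⟨⟨γ, c⟩, rfl⟩, h0, h1⟩ := hfarkas
  refine ⟨c.comp e.symm.toLinearMap, γ, fun i j => ?_⟩
  simp only [LinearMap.comp_apply, LinearEquiv.coe_coe, LinearEquiv.symm_apply_apply]
  exact ⟨fun hj => h0 ⟨i, j⟩ hj, fun hj => h1 ⟨i, j⟩ hj⟩

theorem exists_preservesFaces (n : Fin r → ℕ) (k : ℕ) :
    ∃ f : ((i : Fin r) → Fin (n i + 1) → ℝ) →ₗ[ℝ] (Fin (2 * k + r + 1) → ℝ),
      PreservesFaces f k := by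
  classical
  obtain ⟨w, hw⟩ := exists_separated_configuration n k
  let f : ((i : Fin r) → Fin (n i + 1) → ℝ) →ₗ[ℝ] (Fin (2 * k + r + 1) → ℝ) :=
    ∑ i, ∑ j, ((LinearMap.proj (R := ℝ) (φ := fun _ => ℝ) j).comp
      (LinearMap.proj (φ := fun i => Fin (n i + 1) → ℝ) i)).smulRight (w i j)
  have hf : ∀ x, f x = ∑ i, ∑ j, x i j • w i j := fun x => by
    simp [f, LinearMap.sum_apply]
  refine ⟨f, fun A hA => ?_⟩
  obtain ⟨c, γ, hc⟩ := hw A hA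
  have hsum : ∀ x ∈ prodSimplex n,
      ∑ i, ∑ j, x i j * (γ i + c (w i j)) = ∑ i, γ i + c (f x) := by
    intro x hx
    rw [hf]
    simp only [map_sum, map_smul, smul_eq_mul, mul_add, Finset.sum_add_distrib, ← Finset.sum_mul,
      (mem_prodSimplex.1 hx _).2, one_mul]
  have hterm : ∀ x ∈ prodSimplex n, ∀ i j, 0 ≤ x i j * (γ i + c (w i j)) := by
    intro x hx i j
    by_cases hj : j ∈ A.1 i
    · rw [(hc i j).1 hj, mul_zero]
    · exact mul_nonneg ((mem_prodSimplex.1 hx i).1 j) ((hc i j).2 hj).le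
  have hnonneg : ∀ x ∈ prodSimplex n, 0 ≤ ∑ i, γ i + c (f x) := fun x hx => by
    rw [← hsum x hx]
    exact Finset.sum_nonneg fun i _ => Finset.sum_nonneg fun j _ => hterm x hx i j
  have hzero : ∀ x ∈ prodSimplex n, (∑ i, γ i + c (f x) = 0 ↔ x ∈ boxFace A) := by
    intro x hx
    rw [← hsum x hx]
    constructor
    · intro h
      refine ⟨hx, fun i j hj => ?_⟩
      rw [Finset.sum_eq_zero_iff_of_nonneg fun i _ =>
        Finset.sum_nonneg fun j _ => hterm x hx i j] at h
      have h1 := h i (Finset.mem_univ i)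
      rw [Finset.sum_eq_zero_iff_of_nonneg fun j _ => hterm x hx i j] at h1
      exact (mul_eq_zero.1 (h1 j (Finset.mem_univ j))).resolve_right ((hc i j).2 hj).ne'
    · rintro ⟨-, h⟩
      refine Finset.sum_eq_zero fun i _ => Finset.sum_eq_zero fun j _ => ?_
      by_cases hj : j ∈ A.1 i
      · rw [(hc i j).1 hj, mul_zero]
      · rw [h i j hj, zero_mul]
  obtain ⟨v, hv⟩ := (isFace_boxFace A).1
  have hv0 := (hzero v hv.1).2 hv
  refine ⟨⟨⟨f v, v, hv, rfl⟩, -c, ?_⟩, ?_⟩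
  · ext y
    simp only [Set.mem_ofPred_eq, Set.forall_mem_image, LinearMap.neg_apply, neg_le_neg_iff]
    constructor
    · rintro ⟨x, hx, rfl⟩
      refine ⟨⟨x, hx.1, rfl⟩, fun z hz => ?_⟩
      have h1 := hnonneg z hz
      have h2 := (hzero x hx.1).2 hx
      linarith
    · rintro ⟨⟨x, hx, rfl⟩, h⟩
      refine ⟨x, (hzero x hx).1 ?_, rfl⟩
      have h1 := hnonneg x hx
      have h2 := h hv.1
      linarith
  · rintro x hx ⟨y, hy, hyx⟩
    rw [← hzero x hx, ← hyx]
    exact (hzero y hy.1).2 hy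

end Existence

section LinearImages

variable {E : Type*} [AddCommGroup E] [Module ℝ E] {E' : Type*} [AddCommGroup E'] [Module ℝ E']

lemma IsPolytope.image {P : Set E} (hP : IsPolytope P) (f : E →ₗ[ℝ] E') : IsPolytope (f '' P) := by
  classical
  obtain ⟨V, rfl⟩ := hP
  exact ⟨V.image f, by rw [Finset.coe_image, LinearMap.image_convexHull]⟩

lemma IsFace.image_equiv {P F : Set E} (hF : IsFace P F) (e : E ≃ₗ[ℝ] E') :
    IsFace (e '' P) (e '' F) := by
  obtain ⟨hne, c, rfl⟩ := hF
  refine ⟨hne.image e, c.comp e.symm.toLinearMap, ?_⟩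
  ext y
  obtain ⟨x, rfl⟩ := e.surjective y
  simp

/-- Linear isomorphisms induce isomorphisms of face posets. -/
def facesOfImageIso (P : Set E) (e : E ≃ₗ[ℝ] E') : facesOf P ≃o facesOf (e '' P) where
  toFun F := ⟨e '' F, IsFace.image_equiv F.2 e⟩
  invFun G := ⟨e.symm '' G, by
    have h := IsFace.image_equiv G.2 e.symm
    rwa [Set.image_image, funext fun x => e.symm_apply_apply x, Set.image_id'] at h⟩
  left_inv F := Subtype.ext (by simp [Set.image_image])
  right_inv G := Subtype.ext (by simp [Set.image_image])
  map_rel_iff' := Set.image_subset_image_iff e.injective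

end LinearImages

lemma PreservesFaces.isPPSN {E : Type*} [AddCommGroup E] [Module ℝ E] [FiniteDimensional ℝ E]
    {k r : ℕ} {n : Fin r → ℕ} {f : ((i : Fin r) → Fin (n i + 1) → ℝ) →ₗ[ℝ] E}
    (hf : PreservesFaces f k) : IsPPSN k n (f '' prodSimplex n) := by
  let e := LinearEquiv.ofFinrankEq ((i : Fin r) → Fin (n i + 1) → ℝ)
    (Fin (Module.finrank ℝ ((i : Fin r) → Fin (n i + 1) → ℝ)) → ℝ) (Module.finrank_fin_fun ℝ).symm
  refine ⟨⟨isPolytope_prodSimplex.image f, ⟨(skelIso hf).symm.trans (skelProdSimplexIso k)⟩⟩,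
    _, e '' prodSimplex n, f.comp e.symm.toLinearMap, isPolytope_prodSimplex.image e.toLinearMap,
    ?_, ⟨(facesOfImageIso _ e).symm⟩⟩
  simp [Set.image_image]

/-- Theorem `mainResult`. For `n_i ≥ 2` and
`0 ≤ k ≤ Σ_i ⌊(n_i - 2)/2⌋`, the smallest dimension of a `(k,n̄)`-PPSN polytope is
exactly `2k + r + 1`: such a polytope exists in dimension `2k + r + 1`, and every
`(k,n̄)`-PPSN polytope has dimension at least `2k + r + 1`. -/
theorem statement11 (k r : ℕ) (hr : 1 ≤ r) (n : Fin r → ℕ) (hn : ∀ i, 2 ≤ n i)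
    (hk : k ≤ ∑ i, (n i - 2) / 2) :
    (∃ P : Set (Fin (2 * k + r + 1) → ℝ), IsPPSN k n P ∧ polyDim P = 2 * k + r + 1) ∧
    (∀ (d : ℕ) (P : Set (Fin d → ℝ)), IsPPSN k n P → 2 * k + r + 1 ≤ polyDim P) := by
  refine ⟨?_, fun d P hP => hP.le_polyDim hr hn hk⟩
  obtain ⟨f, hf⟩ := exists_preservesFaces n k
  refine ⟨f '' prodSimplex n, hf.isPPSN, le_antisymm ?_ (hf.isPPSN.le_polyDim hr hn hk)⟩
  exact (Submodule.finrank_le _).trans (Module.finrank_fin_fun ℝ).le
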